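/- arXiv:math/0401343 — 4 statements merged into one kernel-verified Lean document; each statement's English description precedes it below -/
import Mathlib

section
/- Let μ be a singular strong limit cardinal of cofinality ω. Then there is a superatomic Boolean algebra A such that the cardinality of the set of automorphisms of A is at most 2^μ, and 2^μ < |A|. -/
universe u

open Cardinal

/-- A Boolean subalgebra of `A`, as a subset containing `⊥` and `⊤` and closed under
`⊓`, `⊔` and complementation. -/
structure IsBoolSubalgebra {A : Type u} [BooleanAlgebra A] (S : Set A) : Prop where
  bot_mem : ⊥ ∈ S
  top_mem : ⊤ ∈ S
  inf_mem : ∀ x ∈ S, ∀ y ∈ S, x ⊓ y ∈ S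
  sup_mem : ∀ x ∈ S, ∀ y ∈ S, x ⊔ y ∈ S
  compl_mem : ∀ x ∈ S, xᶜ ∈ S

/-- `a` is an atom of the subalgebra with underlying set `S`: a minimal nonzero element
of `S`. -/
def IsAtomOn {A : Type u} [BooleanAlgebra A] (S : Set A) (a : A) : Prop :=
  a ∈ S ∧ a ≠ ⊥ ∧ ∀ c ∈ S, c < a → c = ⊥

/-- A Boolean algebra is superatomic if every Boolean subalgebra of it is atomic, i.e.
every nonzero element of the subalgebra lies above an atom of the subalgebra. -/
def Superatomic (A : Type u) [BooleanAlgebra A] : Prop :=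
  ∀ S : Set A, IsBoolSubalgebra S → ∀ b ∈ S, b ≠ ⊥ → ∃ a, IsAtomOn S a ∧ a ≤ b

/-- `a` is scattered in `L` if there is no nonempty family of nonzero elements of `L` below `a`
each of which splits into two disjoint members of the family. -/
def IsScattered {α : Type u} [BooleanAlgebra α] (L : BooleanSubalgebra α) (a : α) : Prop :=
  ¬∃ S : Set α, S.Nonempty ∧ ∀ s ∈ S, s ∈ L ∧ s ≠ ⊥ ∧ s ≤ a ∧
    ∃ t ∈ S, ∃ t' ∈ S, t ≤ s ∧ t' ≤ s ∧ Disjoint t t'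

namespace IsScattered

variable {α : Type u} [BooleanAlgebra α] {L : BooleanSubalgebra α} {a b : α}

theorem mono (hb : IsScattered L b) (hab : a ≤ b) : IsScattered L a := by
  rintro ⟨S, hS, h⟩
  refine hb ⟨S, hS, fun s hs => ?_⟩
  obtain ⟨h1, h2, h3, h4⟩ := h s hs
  exact ⟨h1, h2, h3.trans hab, h4⟩

theorem bot : IsScattered L (⊥ : α) := by
  rintro ⟨S, ⟨s, hs⟩, h⟩
  obtain ⟨-, h2, h3, -⟩ := h s hs
  exact h2 (le_bot_iff.1 h3)

theorem sup (haL : a ∈ L) (ha : IsScattered L a) (hb : IsScattered L b) :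
    IsScattered L (a ⊔ b) := by
  rintro ⟨S, hS, h⟩
  by_cases hd : ∃ s ∈ S, s ⊓ a = ⊥
  · obtain ⟨s, hs, hsa⟩ := hd
    have hsb : s ≤ b :=
      (disjoint_iff.2 hsa).left_le_of_le_sup_left (h s hs).2.2.1
    refine hb ⟨{t ∈ S | t ≤ s}, ⟨s, hs, le_rfl⟩, fun t ht => ?_⟩
    obtain ⟨h1, h2, h3, r, hr, r', hr', hrt, hrt', hd⟩ := h t ht.1
    exact ⟨h1, h2, ht.2.trans hsb, r, ⟨hr, hrt.trans ht.2⟩, r', ⟨hr', hrt'.trans ht.2⟩,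
      hrt, hrt', hd⟩
  · push Not at hd
    refine ha ⟨(· ⊓ a) '' S, hS.image _, ?_⟩
    rintro _ ⟨s, hs, rfl⟩
    obtain ⟨h1, h2, h3, r, hr, r', hr', hrt, hrt', hdis⟩ := h s hs
    exact ⟨L.inf_mem h1 haL, hd s hs, inf_le_right, _, ⟨r, hr, rfl⟩, _, ⟨r', hr', rfl⟩,
      inf_le_inf_right _ hrt, inf_le_inf_right _ hrt', hdis.mono inf_le_left inf_le_left⟩

theorem of_forall_mem (h : ∀ c ∈ L, IsScattered L (a ⊓ c) ∨ IsScattered L (a \ c)) :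
    IsScattered L a := by
  rintro ⟨S, ⟨s, hs⟩, hS⟩
  have key : ∀ t ∈ S, ¬IsScattered L t := fun t ht hsc => by
    refine hsc ⟨{r ∈ S | r ≤ t}, ⟨t, ht, le_rfl⟩, fun q hq => ?_⟩
    obtain ⟨h1, h2, h3, r, hr, r', hr', hrt, hrt', hd⟩ := hS q hq.1
    exact ⟨h1, h2, hq.2, r, ⟨hr, hrt.trans hq.2⟩, r', ⟨hr', hrt'.trans hq.2⟩, hrt, hrt', hd⟩
  obtain ⟨-, -, -, r, hr, r', hr', -, -, hd⟩ := hS s hs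
  rcases h r (hS r hr).1 with h | h
  · exact key r hr (h.mono (le_inf (hS r hr).2.2.1 le_rfl))
  · exact key r' hr' (h.mono (le_sdiff.2 ⟨(hS r' hr').2.2.1, hd.symm⟩))

theorem of_forall_generator {G : Set α} (ha : a ∈ BooleanSubalgebra.closure G)
    (h : ∀ g ∈ G, IsScattered (BooleanSubalgebra.closure G) (a ⊓ g) ∨
      IsScattered (BooleanSubalgebra.closure G) (a \ g)) :
    IsScattered (BooleanSubalgebra.closure G) a := by
  refine of_forall_mem fun c hc => ?_
  induction hc using BooleanSubalgebra.closure_bot_sup_induction with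
  | mem x hx => exact h x hx
  | bot => left; simpa using bot
  | sup x hx y hy ihx ihy =>
    rcases ihx with ihx | ihx
    · rcases ihy with ihy | ihy
      · left
        rw [inf_sup_left]
        exact sup (BooleanSubalgebra.inf_mem ha hx) ihx ihy
      · exact Or.inr (ihy.mono (sdiff_le_sdiff_left le_sup_right))
    · exact Or.inr (ihx.mono (sdiff_le_sdiff_left le_sup_left))
  | compl x hx ih =>
    rw [← sdiff_eq, sdiff_compl]
    exact ih.symm

end IsScattered

theorem superatomic_of_isScattered_top {α : Type u} [BooleanAlgebra α] (L : BooleanSubalgebra α)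
    (h : IsScattered L (⊤ : α)) : Superatomic L := by
  intro S hS b hb hb0
  by_contra! hno
  refine h ⟨(↑) '' {s : L | s ∈ S ∧ s ≠ ⊥ ∧ s ≤ b}, ⟨_, b, ⟨hb, hb0, le_rfl⟩, rfl⟩, ?_⟩
  rintro _ ⟨s, ⟨hs, hs0, hsb⟩, rfl⟩
  refine ⟨s.2, fun h => hs0 (Subtype.ext h), le_top, ?_⟩
  have hna : ¬IsAtomOn S s := fun h => hno s h hsb
  unfold IsAtomOn at hna
  push Not at hna
  obtain ⟨c, hc, hcs, hc0⟩ := hna hs hs0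
  have hd : s \ c = s ⊓ cᶜ := sdiff_eq
  refine ⟨c, ⟨c, ⟨hc, hc0, hcs.le.trans hsb⟩, rfl⟩, ↑(s \ c),
    ⟨s \ c, ⟨hd ▸ hS.inf_mem _ hs _ (hS.compl_mem _ hc), ?_, sdiff_le.trans hsb⟩, rfl⟩, hcs.le,
    sdiff_le (a := s), ?_⟩
  · rw [Ne, sdiff_eq_bot_iff]
    exact hcs.not_ge
  · exact disjoint_sdiff_self_right (x := (c : α)) (y := s)

/-- The field of sets generated by the singletons, the sets `B i` and the members of `𝓔`. -/
def generatedField {W I : Type u} (B : I → Set W) (𝓔 : Set (Set W)) : BooleanSubalgebra (Set W) :=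
  BooleanSubalgebra.closure (Set.range (fun w => {w}) ∪ Set.range B ∪ 𝓔)

section GeneratedField

variable {W I T : Type u} {B : I → Set W} {𝓔 : Set (Set W)}

theorem singleton_mem_generatedField (w : W) : {w} ∈ generatedField B 𝓔 :=
  BooleanSubalgebra.subset_closure (Or.inl (Or.inl ⟨w, rfl⟩))

theorem mem_generatedField_of_range (i : I) : B i ∈ generatedField B 𝓔 :=
  BooleanSubalgebra.subset_closure (Or.inl (Or.inr ⟨i, rfl⟩))

theorem mem_generatedField_of_mem {E : Set W} (hE : E ∈ 𝓔) : E ∈ generatedField B 𝓔 :=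
  BooleanSubalgebra.subset_closure (Or.inr hE)

theorem isScattered_singleton (L : BooleanSubalgebra (Set W)) (w : W) :
    IsScattered L ({w} : Set W) := by
  refine IsScattered.of_forall_mem fun c _ => ?_
  by_cases h : w ∈ c
  · right
    rw [sdiff_eq_bot_iff.2 (Set.singleton_subset_iff.2 h)]
    exact IsScattered.bot
  · left
    rw [show ({w} : Set W) ⊓ c = ⊥ by simpa using h]
    exact IsScattered.bot

theorem isScattered_of_finite {s : Set W} (hs : s.Finite) :
    IsScattered (generatedField B 𝓔) s := by
  induction s, hs using Set.Finite.induction_on with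
  | empty => exact IsScattered.bot
  | insert _ _ ih =>
    exact IsScattered.sup (singleton_mem_generatedField _) (isScattered_singleton _ _) ih

theorem isScattered_range (hB : ∀ i j, i ≠ j → (B i ∩ B j).Finite)
    (hE : ∀ i, ∀ E ∈ 𝓔, (B i ∩ E).Finite ∨ (B i \ E).Finite) (i : I) :
    IsScattered (generatedField B 𝓔) (B i) := by
  refine IsScattered.of_forall_generator (mem_generatedField_of_range (𝓔 := 𝓔) i) ?_
  rintro g ((⟨w, rfl⟩ | ⟨j, rfl⟩) | hg)
  · exact Or.inl ((isScattered_singleton _ w).mono inf_le_right)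
  · rcases eq_or_ne i j with rfl | hij
    · right
      rw [sdiff_self]
      exact IsScattered.bot
    · exact Or.inl (isScattered_of_finite (hB i j hij))
  · exact (hE i g hg).imp isScattered_of_finite isScattered_of_finite

theorem isScattered_of_mem (hB : ∀ i j, i ≠ j → (B i ∩ B j).Finite)
    (hE : ∀ i, ∀ E ∈ 𝓔, (B i ∩ E).Finite ∨ (B i \ E).Finite)
    (hcap : ∀ E ∈ 𝓔, ∀ E' ∈ 𝓔, E ∩ E' ∈ 𝓔) (hwf : 𝓔.WellFoundedOn (· ⊂ ·))
    {E : Set W} (h : E ∈ 𝓔) : IsScattered (generatedField B 𝓔) E := by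
  refine hwf.induction (P := fun E => IsScattered (generatedField B 𝓔) E) h fun E hE₀ ih => ?_
  refine IsScattered.of_forall_generator (mem_generatedField_of_mem (B := B) hE₀) ?_
  rintro g ((⟨w, rfl⟩ | ⟨j, rfl⟩) | hg)
  · exact Or.inl ((isScattered_singleton _ w).mono inf_le_right)
  · exact Or.inl ((isScattered_range hB hE j).mono inf_le_right)
  · by_cases hle : E ⊆ g
    · right
      rw [sdiff_eq_bot_iff.2 hle]
      exact IsScattered.bot
    · exact Or.inl (ih _ (hcap E hE₀ g hg)
        ⟨Set.inter_subset_left, fun h => hle (h.trans Set.inter_subset_right)⟩)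

theorem isScattered_top (hB : ∀ i j, i ≠ j → (B i ∩ B j).Finite)
    (hE : ∀ i, ∀ E ∈ 𝓔, (B i ∩ E).Finite ∨ (B i \ E).Finite)
    (hcap : ∀ E ∈ 𝓔, ∀ E' ∈ 𝓔, E ∩ E' ∈ 𝓔) (hwf : 𝓔.WellFoundedOn (· ⊂ ·)) :
    IsScattered (generatedField B 𝓔) ⊤ := by
  refine IsScattered.of_forall_generator (BooleanSubalgebra.top_mem) ?_
  rintro g ((⟨w, rfl⟩ | ⟨j, rfl⟩) | hg)
  · exact Or.inl ((isScattered_singleton _ w).mono inf_le_right)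
  · exact Or.inl ((isScattered_range hB hE j).mono inf_le_right)
  · exact Or.inl ((isScattered_of_mem hB hE hcap hwf hg).mono inf_le_right)

theorem exists_preimage_symmDiff_of_mem_generatedField {π : W → T}
    (h𝓔 : ∀ E ∈ 𝓔, ∃ s, E = π ⁻¹' s) {c : Set W} (hc : c ∈ generatedField B 𝓔) :
    ∃ (s : Set T) (F : Set I), F.Finite ∧ (symmDiff c (π ⁻¹' s) \ ⋃ i ∈ F, B i).Finite := by
  induction hc using BooleanSubalgebra.closure_bot_sup_induction with
  | mem x hx =>
    obtain (⟨w, rfl⟩ | ⟨j, rfl⟩) | hg := hx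
    · refine ⟨∅, ∅, Set.finite_empty, (Set.finite_singleton w).subset ?_⟩
      simp
    · refine ⟨∅, {j}, Set.finite_singleton j, ?_⟩
      simp
    · obtain ⟨s, rfl⟩ := h𝓔 x hg
      exact ⟨s, ∅, Set.finite_empty, by simp⟩
  | bot => exact ⟨∅, ∅, Set.finite_empty, by simp⟩
  | sup x hx y hy ihx ihy =>
    obtain ⟨s, F, hF, h⟩ := ihx
    obtain ⟨s', F', hF', h'⟩ := ihy
    refine ⟨s ∪ s', F ∪ F', hF.union hF', (h.union h').subset ?_⟩
    intro w
    simp only [Set.mem_sdiff, Set.mem_symmDiff, Set.mem_preimage, Set.mem_union, Set.mem_iUnion,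
      Set.sup_eq_union, not_exists]
    grind
  | compl x hx ih =>
    obtain ⟨s, F, hF, h⟩ := ih
    refine ⟨sᶜ, F, hF, ?_⟩
    rwa [Set.preimage_compl, compl_symmDiff_compl]

theorem finite_sdiff_of_countable_of_mem_generatedField {π : W → T}
    (h𝓔 : ∀ E ∈ 𝓔, ∃ s, E = π ⁻¹' s) (hπ : ∀ t, ¬(π ⁻¹' {t}).Countable)
    (hBc : ∀ i, (B i).Countable) {c : Set W} (hc : c ∈ generatedField B 𝓔) (hcc : c.Countable) :
    ∃ F : Set I, F.Finite ∧ (c \ ⋃ i ∈ F, B i).Finite := by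
  obtain ⟨s, F, hF, h⟩ := exists_preimage_symmDiff_of_mem_generatedField h𝓔 hc
  suffices hs : s = ∅ by
    subst hs
    exact ⟨F, hF, by rwa [Set.preimage_empty, ← Set.bot_eq_empty, symmDiff_bot] at h⟩
  by_contra hs
  obtain ⟨t, ht⟩ := Set.nonempty_iff_ne_empty.2 hs
  refine hπ t (((hcc.union h.countable).union
    (hF.countable.biUnion fun i _ => hBc i)).mono ?_)
  intro w hw
  have hw' : π w ∈ s := by rw [Set.mem_preimage, Set.mem_singleton_iff] at hw; rwa [hw]
  by_cases h1 : w ∈ c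
  · exact Or.inl (Or.inl h1)
  · by_cases h2 : w ∈ ⋃ i ∈ F, B i
    · exact Or.inr h2
    · exact Or.inl (Or.inr ⟨Or.inr ⟨hw', h1⟩, h2⟩)

end GeneratedField

theorem exists_infinite_subset_forall_inter_finite_or_subset {W : Type u} {𝓔 : Set (Set W)}
    (hcap : ∀ E ∈ 𝓔, ∀ E' ∈ 𝓔, E ∩ E' ∈ 𝓔) (hwf : 𝓔.WellFoundedOn (· ⊂ ·))
    {K : Set W} (hK : K.Infinite) :
    ∃ K' ⊆ K, K'.Infinite ∧ ∀ E ∈ 𝓔, (K' ∩ E).Finite ∨ K' ⊆ E := by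
  by_cases h : ∃ E ∈ 𝓔, (K ∩ E).Infinite
  · have key : ∀ E ∈ 𝓔, (K ∩ E).Infinite →
        ∃ K' ⊆ K, K'.Infinite ∧ ∀ E ∈ 𝓔, (K' ∩ E).Finite ∨ K' ⊆ E := by
      intro E hE
      refine hwf.induction (P := fun E => (K ∩ E).Infinite → _) hE fun E hE ih => ?_
      intro hKE
      by_cases h' : ∃ E' ∈ 𝓔, ¬E ⊆ E' ∧ (K ∩ (E ∩ E')).Infinite
      · obtain ⟨E', hE', hne, hinf⟩ := h'
        exact ih _ (hcap E hE E' hE')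
          ⟨Set.inter_subset_left, fun h => hne (h.trans Set.inter_subset_right)⟩ hinf
      · push Not at h'
        refine ⟨K ∩ E, Set.inter_subset_left, hKE, fun E' hE' => ?_⟩
        by_cases hEE' : E ⊆ E'
        · exact Or.inr (Set.inter_subset_right.trans hEE')
        · left
          rw [Set.inter_assoc]
          exact h' E' hE' hEE'
    obtain ⟨E, hE, hKE⟩ := h
    exact key E hE hKE
  · push Not at h
    exact ⟨K, subset_rfl, hK, fun E hE => Or.inl (h E hE)⟩

/-- The set of finite initial segments of a sequence. -/
def branch {M : Type u} (x : ℕ → M) : Set (List M) :=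
  Set.range fun n => (List.range n).map x

section Branch

variable {M : Type u}

theorem branch_injective (x : ℕ → M) :
    Function.Injective fun n => (List.range n).map x := fun m n h => by
  simpa using congrArg List.length h

theorem branch_infinite (x : ℕ → M) : (branch x).Infinite :=
  Set.infinite_range_of_injective (branch_injective x)

theorem branch_countable (x : ℕ → M) : (branch x).Countable :=
  Set.countable_range _

theorem branch_inter_finite {x y : ℕ → M} (h : x ≠ y) : (branch x ∩ branch y).Finite := by
  obtain ⟨k, hk⟩ := Function.ne_iff.1 h
  refine ((Set.finite_Iic k).image fun n => (List.range n).map x).subset ?_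
  rintro _ ⟨⟨n, rfl⟩, m, hm⟩
  refine ⟨n, ?_, rfl⟩
  by_contra! hkn
  dsimp only at hm
  obtain rfl : m = n := by simpa using congrArg List.length hm
  rw [List.map_inj_left] at hm
  exact hk (hm k (List.mem_range.2 (not_le.1 hkn))).symm

theorem mk_branch_inter_infinite_le {N : Set (List M)} (hN : N.Countable) :
    #{x : ℕ → M // (branch x ∩ N).Infinite} ≤ 2 ^ ℵ₀ := by
  have h1 : #{x : ℕ → M // (branch x ∩ N).Infinite} ≤ #(Set N) := by
    refine mk_le_of_injective (f := fun x => (↑) ⁻¹' branch x.1) ?_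
    intro x y hxy
    by_contra hne
    refine x.2 ((branch_inter_finite fun h => hne (Subtype.ext h)).subset ?_)
    rintro s ⟨hs, hsN⟩
    exact ⟨hs, (Set.ext_iff.1 hxy ⟨s, hsN⟩).1 hs⟩
  rw [mk_set] at h1
  exact h1.trans (power_le_power_left two_ne_zero (le_aleph0_iff_set_countable.2 hN))

theorem exists_forall_branch_inter_finite {ι : Type u} {N : ι → Set (List M)}
    (hN : ∀ k, (N k).Countable) (hι : #ι < #M ^ ℵ₀) (hM : 2 ^ ℵ₀ < #M ^ ℵ₀) :
    ∃ x : ℕ → M, ∀ k, (branch x ∩ N k).Finite := by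
  by_contra! h
  have huniv : (Set.univ : Set (ℕ → M)) ⊆ ⋃ k, {x | (branch x ∩ N k).Infinite} := fun x _ =>
    Set.mem_iUnion.2 (h x)
  have hle : #M ^ ℵ₀ ≤ #ι * 2 ^ ℵ₀ := by
    calc #M ^ ℵ₀ = #(Set.univ : Set (ℕ → M)) := by simp
      _ ≤ _ := mk_le_mk_of_subset huniv
      _ ≤ sum fun k => #{x | (branch x ∩ N k).Infinite} := mk_iUnion_le_sum_mk
      _ ≤ sum fun _ : ι => 2 ^ ℵ₀ := sum_le_sum _ _ fun k => mk_branch_inter_infinite_le (hN k)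
      _ = #ι * 2 ^ ℵ₀ := by simp
  exact hle.not_gt (mul_lt_of_lt ((cantor _).le.trans hM.le) hι hM)

end Branch

/-- The union of the images of `b` under `u` and `v`. -/
def imagePair {M W : Type u} (u v : M → W) (b : Set M) : Set W := u '' b ∪ v '' b

theorem exists_image_inter_finite {M W : Type u} {𝓔 : Set (Set W)}
    (hcap : ∀ E ∈ 𝓔, ∀ E' ∈ 𝓔, E ∩ E' ∈ 𝓔) (hwf : 𝓔.WellFoundedOn (· ⊂ ·))
    {u v : List M → W} (hu : u.Injective) (hv : v.Injective) {ι : Type u} {P : ι → Set W}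
    (hP : ∀ k, (P k).Countable) (hι : #ι < #M ^ ℵ₀) (hM : 2 ^ ℵ₀ < #M ^ ℵ₀) :
    ∃ b : Set (List M), b.Infinite ∧ b.Countable ∧
      (∀ E ∈ 𝓔, (u '' b ∩ E).Finite ∨ u '' b ⊆ E) ∧
      ∀ k, (imagePair u v b ∩ P k).Finite := by
  obtain ⟨x, hx⟩ := exists_forall_branch_inter_finite
    (N := fun k => u ⁻¹' P k ∪ v ⁻¹' P k)
    (fun k => ((hP k).preimage hu).union ((hP k).preimage hv)) hι hM
  obtain ⟨K, hK, hKinf, hKE⟩ := exists_infinite_subset_forall_inter_finite_or_subset hcap hwf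
    ((branch_infinite x).image hu.injOn)
  obtain ⟨b, hb, rfl⟩ := Set.subset_image_iff.1 hK
  refine ⟨b, hKinf.of_image u, (branch_countable x).mono hb, hKE, fun k => ?_⟩
  refine (((hx k).image u).union ((hx k).image v)).subset ?_
  rintro w ⟨⟨s, hs, rfl⟩ | ⟨s, hs, rfl⟩, hw⟩
  · exact Or.inl ⟨s, ⟨hb hs, Or.inl hw⟩, rfl⟩
  · exact Or.inr ⟨s, ⟨hb hs, Or.inr hw⟩, rfl⟩

theorem exists_almost_disjoint_images {M W I : Type u} {𝓔 : Set (Set W)}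
    (hcap : ∀ E ∈ 𝓔, ∀ E' ∈ 𝓔, E ∩ E' ∈ 𝓔) (hwf : 𝓔.WellFoundedOn (· ⊂ ·))
    {u v : I → List M → W} (hu : ∀ i, (u i).Injective) (hv : ∀ i, (v i).Injective)
    (hI : #I ≤ #M ^ ℵ₀) (hM : 2 ^ ℵ₀ < #M ^ ℵ₀) :
    ∃ b : I → Set (List M), (∀ i, (b i).Infinite) ∧ (∀ i, (b i).Countable) ∧
      (∀ i, ∀ E ∈ 𝓔, (u i '' b i ∩ E).Finite ∨ u i '' b i ⊆ E) ∧
      ∀ i j, i ≠ j → (imagePair (u i) (v i) (b i) ∩ imagePair (u j) (v j) (b j)).Finite := by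
  obtain ⟨r, hr, hord⟩ := exists_ord_eq I
  have step : ∀ i (f : ∀ j, r j i → {b : Set (List M) // b.Countable}),
      ∃ b : {b : Set (List M) // b.Countable}, b.1.Infinite ∧
        (∀ E ∈ 𝓔, (u i '' b.1 ∩ E).Finite ∨ u i '' b.1 ⊆ E) ∧
        ∀ j (h : r j i), (imagePair (u i) (v i) b.1 ∩ imagePair (u j) (v j) (f j h).1).Finite := by
    intro i f
    obtain ⟨b, h1, h2, h3, h4⟩ := exists_image_inter_finite hcap hwf (hu i) (hv i)
      (ι := {j // r j i}) (P := fun j => imagePair (u j.1) (v j.1) (f j.1 j.2).1)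
      (fun j => ((f j.1 j.2).2.image _).union ((f j.1 j.2).2.image _))
      ((card_typein_lt i hord).trans_le hI) hM
    exact ⟨⟨b, h2⟩, h1, h3, fun j h => h4 ⟨j, h⟩⟩
  choose F hF1 hF2 hF3 using step
  have hwfr : WellFounded r := hr.toIsWellFounded.wf
  have hfix : ∀ i, hwfr.fix F i = F i fun j _ => hwfr.fix F j := fun i => hwfr.fix_eq F i
  have hlt : ∀ i j, r j i → (imagePair (u i) (v i) (hwfr.fix F i).1 ∩
      imagePair (u j) (v j) (hwfr.fix F j).1).Finite := fun i j h => by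
    have := hF3 i (fun j _ => hwfr.fix F j) j h
    rwa [← hfix] at this
  refine ⟨fun i => (hwfr.fix F i).1, fun i => ?_, fun i => (hwfr.fix F i).2, fun i => ?_,
    fun i j hij => ?_⟩
  · dsimp only
    rw [hfix]
    exact hF1 _ _
  · have := hF2 i fun j _ => hwfr.fix F j
    rwa [← hfix] at this
  · rcases trichotomous_of r i j with h | h | h
    · rw [Set.inter_comm]
      exact hlt j i h
    · exact absurd h hij
    · exact hlt i j h

section Tree

variable {Λ M : Type u} [LinearOrder Λ]

/-- The cylinder with fibre `M` over the part lying in `D` of the branch `x` of the binary tree of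
height `Λ`. -/
def branchCylinder (x : Λ → Bool) (D : LowerSet Λ) : Set ((Σ β : Λ, Set.Iic β → Bool) × M) :=
  Prod.fst ⁻¹' {t | t.1 ∈ D ∧ ∀ γ : Set.Iic t.1, t.2 γ = x γ}

variable (Λ M) in
/-- The family of all cylinders over initial segments of branches. -/
def branchCylinders : Set (Set ((Σ β : Λ, Set.Iic β → Bool) × M)) :=
  Set.range fun p : (Λ → Bool) × LowerSet Λ => branchCylinder p.1 p.2

theorem inter_mem_branchCylinders :
    ∀ E ∈ branchCylinders Λ M, ∀ E' ∈ branchCylinders Λ M, E ∩ E' ∈ branchCylinders Λ M := by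
  rintro _ ⟨⟨x, D⟩, rfl⟩ _ ⟨⟨y, D'⟩, rfl⟩
  refine ⟨⟨x, D ⊓ D' ⊓ ⟨{β | ∀ γ ≤ β, x γ = y γ}, fun a b hba ha γ hγ => ha γ (hγ.trans hba)⟩⟩, ?_⟩
  ext ⟨⟨β, s⟩, m⟩
  constructor
  · rintro ⟨⟨⟨h1, h2⟩, h3⟩, h4⟩
    exact ⟨⟨h1, h4⟩, h2, fun γ => (h4 γ).trans (h3 γ γ.2)⟩
  · rintro ⟨⟨h1, h4⟩, h2, h5⟩
    exact ⟨⟨⟨h1, h2⟩, fun γ hγ => (h4 ⟨γ, hγ⟩).symm.trans (h5 ⟨γ, hγ⟩)⟩, h4⟩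

theorem wellFoundedOn_branchCylinders [WellFoundedLT Λ] :
    (branchCylinders Λ M).WellFoundedOn (· ⊂ ·) := by
  rw [Set.wellFoundedOn_iff_no_descending_seq]
  intro f hf
  choose p hp using hf
  have hss : ∀ n, f (n + 1) ⊂ f n := fun n => f.map_rel_iff.2 (Nat.lt_succ_self n)
  choose t ht ht' using fun n => Set.exists_of_ssubset (hss n)
  have hdesc : ∀ n, (t (n + 1)).1.1 < (t n).1.1 := by
    intro n
    by_contra! hle
    have h0 := ht n
    have h1 := ht (n + 1)
    have h2 := (hss n).subset h1
    refine ht' n ?_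
    rw [← hp] at h0 h1 h2 ⊢
    refine ⟨(p (n + 1)).2.lower hle h1.1, fun γ => ?_⟩
    have hγ : (γ : Λ) ≤ (t (n + 1)).1.1 := le_trans γ.2 hle
    rw [h0.2 γ, ← h1.2 ⟨γ, hγ⟩, h2.2 ⟨γ, hγ⟩]
  exact (RelEmbedding.natGT _ hdesc).not_wellFounded wellFounded_lt

theorem exists_eq_preimage_fst_of_mem_branchCylinders :
    ∀ E ∈ branchCylinders Λ M, ∃ s, E = Prod.fst ⁻¹' s := by
  rintro _ ⟨p, rfl⟩
  exact ⟨_, rfl⟩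

theorem two_power_le_mk_branchCylinders [Nonempty M] :
    2 ^ #Λ ≤ #(branchCylinders Λ M) := by
  rw [show (2 : Cardinal.{u}) ^ #Λ = #(Λ → Bool) by simp]
  refine mk_le_of_injective (f := fun x => ⟨branchCylinder x ⊤, ⟨x, ⊤⟩, rfl⟩) fun x y h => ?_
  obtain ⟨m⟩ := ‹Nonempty M›
  ext1 β
  have hx : ((⟨β, fun γ => x γ⟩, m) : (Σ β : Λ, Set.Iic β → Bool) × M) ∈ branchCylinder x ⊤ :=
    ⟨trivial, fun _ => rfl⟩
  rw [show branchCylinder x ⊤ = branchCylinder y ⊤ from congrArg Subtype.val h] at hx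
  exact hx.2 ⟨β, le_rfl⟩

theorem mk_tree_le [WellFoundedLT Λ] {κ : Cardinal.{u}}
    (hord : ord #Λ = Ordinal.type (α := Λ) (· < ·))
    (hΛ : ℵ₀ ≤ #Λ) (hκ : #Λ ≤ κ) (hpow : ∀ ν < #Λ, 2 ^ ν ≤ κ) :
    #(Σ β : Λ, Set.Iic β → Bool) ≤ κ := by
  rw [mk_sigma]
  calc _ ≤ sum fun _ : Λ => κ := sum_le_sum _ _ fun β => ?_
    _ = #Λ * κ := by simp
    _ ≤ κ * κ := mul_le_mul_left hκ κ
    _ = κ := mul_eq_self (hΛ.trans hκ)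
  have hlt : #(Set.Iic β) < #Λ := by
    rw [← Set.Iio_insert]
    exact mk_insert_le.trans_lt (add_lt_of_lt hΛ (mk_Iio_lt β hord)
      (one_lt_aleph0.trans_le hΛ))
  simpa using hpow _ hlt

end Tree

theorem power_aleph0_eq_two_power {μ : Cardinal.{u}} (hμ : ℵ₀ ≤ μ) (hcof : μ.ord.cof = ℵ₀)
    (hsl : ∀ ν : Cardinal.{u}, ν < μ → 2 ^ ν < μ) : μ ^ ℵ₀ = 2 ^ μ := by
  refine le_antisymm ?_ ?_
  · calc μ ^ ℵ₀ ≤ (2 ^ μ) ^ ℵ₀ := power_le_power_right (cantor μ).le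
      _ = 2 ^ μ := by rw [← power_mul, mul_eq_left hμ hμ aleph0_ne_zero]
  · set X := μ.ord.ToType
    have hX : #X = μ := by simp [X]
    have hord : (#X).ord = Ordinal.type (α := X) (· < ·) := by simp [X]
    have hcofX : Order.cof X = ℵ₀ := by rw [Ordinal.cof_toType, hcof]
    obtain ⟨S, hS, hScard⟩ := Order.exists_cof_eq X
    rw [hcofX] at hScard
    have hSc : S.Countable := le_aleph0_iff_set_countable.1 hScard.le
    have hSne : S.Nonempty := by
      rw [Set.nonempty_iff_ne_empty]
      rintro rfl
      exact aleph0_ne_zero (by simpa using hScard.symm)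
    obtain ⟨f, rfl⟩ := hSc.exists_eq_range hSne
    have hpre : IsStrongPrelimit #X := by
      rw [hX]
      exact fun x hx => hsl x hx
    have hno : NoTopOrder X := by
      rw [← Order.cof_ne_one_iff, hcofX]
      exact one_lt_aleph0.ne'
    rw [← hX, ← mk_set]
    conv_rhs => rw [← mk_bounded_subset hpre hord]
    have : #(ℕ → {s : Set X // Set.Bounded (· < ·) s}) =
      #{s : Set X // Set.Bounded (· < ·) s} ^ ℵ₀ := by simp
    rw [← this]
    refine mk_le_of_injective (f := fun s n => ⟨s ∩ Set.Iio (f n), f n, fun x hx => hx.2⟩) ?_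
    intro s t hst
    ext x
    obtain ⟨y, hy⟩ := exists_not_le x
    obtain ⟨_, ⟨n, rfl⟩, hn⟩ := hS y
    have hx : x < f n := (not_le.1 hy).trans_le hn
    have h := Set.ext_iff.1 (congrArg Subtype.val (congrFun hst n)) x
    simpa [hx] using h

theorem exists_injective_forall_orderIso_eq_image {W : Type u} (L : BooleanSubalgebra (Set W))
    (hL : ∀ w, {w} ∈ L) (φ : L ≃o L) :
    ∃ f : W → W, f.Injective ∧ ∀ c : L, (φ c : Set W) = f '' c := by
  have hatom : ∀ w, IsAtom (⟨{w}, hL w⟩ : L) := fun w => by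
    refine ⟨fun h => Set.singleton_ne_empty w (congrArg Subtype.val h), fun c hc => ?_⟩
    exact Subtype.ext (Set.ssubset_singleton_iff.1 hc)
  have hex : ∀ a : L, IsAtom a → ∃ w, a = ⟨{w}, hL w⟩ := fun a ha => by
    obtain ⟨w, hw⟩ := Set.nonempty_iff_ne_empty.2 fun h : (a : Set W) = ∅ => ha.1 (Subtype.ext h)
    exact ⟨w, ((ha.le_iff_eq (hatom w).1).1
      (show ({w} : Set W) ⊆ a from Set.singleton_subset_iff.2 hw)).symm⟩
  choose f hf using fun w => hex _ ((φ.isAtom_iff _).2 (hatom w))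
  have hmem : ∀ w (c : L), w ∈ (c : Set W) ↔ f w ∈ (φ c : Set W) := fun w c => by
    rw [← Set.singleton_subset_iff, ← Set.singleton_subset_iff]
    have h : (⟨{w}, hL w⟩ : L) ≤ c ↔ (⟨{f w}, hL (f w)⟩ : L) ≤ φ c := by
      rw [← hf, φ.le_iff_le]
    exact h
  refine ⟨f, fun w w' h => ?_, fun c => ?_⟩
  · have := (hmem w ⟨{w'}, hL w'⟩).2
    rw [hf, h] at this
    exact this rfl
  · ext v
    constructor
    · intro hv
      obtain ⟨w, hw⟩ := hex _ ((φ.symm.isAtom_iff _).2 (hatom v))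
      rw [φ.symm_apply_eq, hf] at hw
      have hvw : v = f w := Set.singleton_injective (congrArg Subtype.val hw)
      subst hvw
      exact ⟨w, (hmem w c).2 hv, rfl⟩
    · rintro ⟨w, hw, rfl⟩
      exact (hmem w c).1 hw

theorem exists_disjoint_image {W : Type u} {f : W → W} (hf : f.Injective) {μ : Cardinal.{u}}
    (hμ : ℵ₀ ≤ μ) (h : μ < #{w | f w ≠ w}) : ∃ C : Set W, Disjoint C (f '' C) ∧ μ < #C := by
  obtain ⟨C, hC⟩ := zorn_subset {C : Set W | Disjoint C (f '' C)} fun c hcS hc => by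
    refine ⟨⋃₀ c, ?_, fun s hs => Set.subset_sUnion_of_mem hs⟩
    rw [Set.mem_ofPred_eq, Set.disjoint_left]
    rintro _ ⟨s, hs, hxs⟩ ⟨y, ⟨t, ht, hyt⟩, rfl⟩
    rcases hc.total hs ht with hst | hst
    · exact Set.disjoint_left.1 (hcS ht) (hst hxs) ⟨y, hyt, rfl⟩
    · exact Set.disjoint_left.1 (hcS hs) hxs ⟨y, hst hyt, rfl⟩
  refine ⟨C, hC.prop, ?_⟩
  by_contra! hle
  refine h.not_ge ?_
  have hsub : {w | f w ≠ w} ⊆ (C ∪ f '' C) ∪ f ⁻¹' C := by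
    intro w hw
    by_contra hno
    simp only [Set.mem_union, not_or] at hno
    obtain ⟨⟨h1, h2⟩, h3⟩ := hno
    refine h1 (hC.le_of_ge (y := insert w C) ?_ (Set.subset_insert w C) (Set.mem_insert w C))
    rw [Set.mem_ofPred_eq, Set.image_insert_eq, Set.disjoint_insert_left,
      Set.disjoint_insert_right]
    refine ⟨?_, h3, hC.prop⟩
    rintro (h | h)
    · exact hw h.symm
    · exact h2 h
  calc _ ≤ _ := mk_le_mk_of_subset hsub
    _ ≤ #C + #C + #C := (mk_union_le _ _).trans (add_le_add ((mk_union_le _ _).trans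
        (add_le_add le_rfl mk_image_le)) (mk_preimage_of_injective _ _ hf))
    _ ≤ μ + μ + μ := add_le_add (add_le_add hle hle) hle
    _ = μ := by rw [add_eq_self hμ, add_eq_self hμ]

theorem mk_orderIso_le {W : Type u} (L : BooleanSubalgebra (Set W)) {μ κ : Cardinal.{u}}
    (hκ : ℵ₀ ≤ κ) (hκμ : κ ^ μ = κ) (hW : #W ≤ κ)
    (h : ∀ φ : L ≃o L, ∃ f : W → W, #{w | f w ≠ w} ≤ μ ∧ ∀ c : L, (φ c : Set W) = f '' c) :
    #(L ≃o L) ≤ κ := by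
  choose F hF hFc using h
  have hle : #(L ≃o L) ≤ #{t : Set (W × W) // #t ≤ μ} := by
    refine mk_le_of_injective
      (f := fun φ => ⟨(fun w => (w, F φ w)) '' {w | F φ w ≠ w}, mk_image_le.trans (hF φ)⟩) ?_
    intro φ ψ hφψ
    have hset := Set.ext_iff.1 (congrArg Subtype.val hφψ)
    have key : ∀ φ w v, (w, v) ∈ (fun w => (w, F φ w)) '' {w | F φ w ≠ w} ↔
        F φ w ≠ w ∧ F φ w = v := by
      intro φ w v
      constructor
      · rintro ⟨w', h1, h2⟩
        obtain ⟨rfl, rfl⟩ := Prod.ext_iff.1 h2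
        exact ⟨h1, rfl⟩
      · rintro ⟨h1, rfl⟩
        exact ⟨w, h1, rfl⟩
    have heq : F φ = F ψ := by
      ext1 w
      have h1 := hset (w, F φ w)
      have h2 := hset (w, F ψ w)
      rw [key, key] at h1 h2
      grind
    refine DFunLike.ext _ _ fun c => Subtype.ext (by rw [hFc, hFc, heq])
  refine hle.trans ((mk_bounded_set_le _ _).trans ?_)
  rw [← hκμ]
  refine power_le_power_right (max_le ?_ hκ)
  rw [mk_prod, lift_id, ← mul_eq_self hκ]
  exact mul_le_mul' hW hW

/-- The pairs of injections of `N` into `W` with disjoint ranges. -/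
def DisjointInjections (N W : Type u) : Type u :=
  {p : (N → W) × (N → W) // p.1.Injective ∧ p.2.Injective ∧
    Disjoint (Set.range p.1) (Set.range p.2)}

theorem mk_disjointInjections_le {N W : Type u} {κ : Cardinal.{u}} (hκ : ℵ₀ ≤ κ)
    (hκN : κ ^ #N = κ) (hW : #W ≤ κ) : #(DisjointInjections N W) ≤ κ := by
  refine (mk_subtype_le _).trans ?_
  have h : #W ^ #N ≤ κ := (power_le_power_right hW).trans hκN.le
  rw [mk_prod, lift_id, mk_arrow, lift_id, lift_id, ← mul_eq_self hκ]
  exact mul_le_mul' h h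

theorem stmt_14 (μ : Cardinal.{u}) (hμ : ℵ₀ < μ) (hcof : μ.ord.cof = ℵ₀)
    (hsl : ∀ ν : Cardinal.{u}, ν < μ → 2 ^ ν < μ) :
    ∃ (A : Type u) (_ : BooleanAlgebra A), Superatomic A ∧
      #(A ≃o A) ≤ 2 ^ μ ∧ 2 ^ μ < #A := by
  obtain ⟨lam, hlam, hmin⟩ : ∃ lam : Cardinal.{u},
      (2 : Cardinal.{u}) ^ μ < 2 ^ lam ∧ ∀ ν < lam, (2 : Cardinal.{u}) ^ ν ≤ 2 ^ μ := by
    have hne : {lam : Cardinal.{u} | (2 : Cardinal.{u}) ^ μ < 2 ^ lam}.Nonempty := ⟨2 ^ μ, cantor _⟩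
    exact ⟨sInf _, csInf_mem hne, fun ν hν => not_lt.1 fun h => notMem_of_lt_csInf' hν h⟩
  have hμlam : μ < lam := by
    by_contra! h
    exact hlam.not_ge (power_le_power_left two_ne_zero h)
  have hlamκ : lam ≤ 2 ^ μ := by
    by_contra! h
    exact (cantor _).not_ge (hmin _ h)
  have hκ : ℵ₀ ≤ (2 : Cardinal.{u}) ^ μ := hμ.le.trans (cantor μ).le
  have hκμ : ((2 : Cardinal.{u}) ^ μ) ^ μ = 2 ^ μ := by rw [← power_mul, mul_eq_self hμ.le]
  have hpow := power_aleph0_eq_two_power hμ.le hcof hsl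
  let M := μ.ord.ToType
  have hM : #M = μ := by simp [M]
  have hMinf : Infinite M := infinite_iff.2 (hM ▸ hμ.le)
  have hN : #(List M) = μ := (mk_list_eq_mk M).trans hM
  let Λ := lam.ord.ToType
  have hΛ : #Λ = lam := by simp [Λ]
  let W := (Σ β : Λ, Set.Iic β → Bool) × M
  have hW : #W ≤ 2 ^ μ := by
    have hT : #(Σ β : Λ, Set.Iic β → Bool) ≤ 2 ^ μ :=
      mk_tree_le (by simp [Λ]) (hΛ ▸ (hμ.trans hμlam).le) (hΛ ▸ hlamκ) (hΛ ▸ hmin)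
    rw [mk_prod, lift_id, lift_id, hM, ← mul_eq_self hκ]
    exact mul_le_mul' hT (cantor μ).le
  let I := DisjointInjections (List M) W
  have hI : #I ≤ #M ^ ℵ₀ := by
    rw [hM, hpow]
    exact mk_disjointInjections_le hκ (hN ▸ hκμ) hW
  obtain ⟨b, hbinf, hbc, hbE, hbad⟩ := exists_almost_disjoint_images
    (inter_mem_branchCylinders (Λ := Λ) (M := M)) wellFoundedOn_branchCylinders
    (u := fun i : I => i.1.1) (v := fun i : I => i.1.2) (fun i => i.2.1) (fun i => i.2.2.1) hI
    (by rw [hM, hpow]; exact (hsl _ hμ).trans (cantor μ))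
  let B : I → Set W := fun i => i.1.1 '' b i
  have hB : ∀ i j, i ≠ j → (B i ∩ B j).Finite := fun i j hij =>
    (hbad i j hij).subset (Set.inter_subset_inter Set.subset_union_left Set.subset_union_left)
  have hE : ∀ i, ∀ E ∈ branchCylinders Λ M, (B i ∩ E).Finite ∨ (B i \ E).Finite := fun i E hE =>
    (hbE i E hE).imp_right fun h => by
      rw [Set.sdiff_eq_empty.2 h]
      exact Set.finite_empty
  let L := generatedField B (branchCylinders Λ M)
  have hfib : ∀ t : (Σ β : Λ, Set.Iic β → Bool),
      ¬((Prod.fst ⁻¹' {t} : Set W)).Countable := fun t h => by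
    have h' : (Set.univ : Set M).Countable :=
      (h.preimage (f := fun m => (t, m)) (Prod.mk_right_injective t)).mono fun m _ => rfl
    rw [← le_aleph0_iff_set_countable, mk_univ, hM] at h'
    exact h'.not_gt hμ
  refine ⟨L, inferInstance, ?_, ?_, ?_⟩
  · exact superatomic_of_isScattered_top L (isScattered_top hB hE inter_mem_branchCylinders
      wellFoundedOn_branchCylinders)
  · refine mk_orderIso_le L hκ hκμ hW fun φ => ?_
    obtain ⟨f, hf, hφ⟩ := exists_injective_forall_orderIso_eq_image L
      singleton_mem_generatedField φ
    refine ⟨f, ?_, hφ⟩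
    by_contra! hlt
    obtain ⟨C, hC, hCμ⟩ := exists_disjoint_image hf hμ.le hlt
    obtain ⟨g⟩ : Nonempty (List M ↪ C) := by
      rw [← le_def, hN]
      exact hCμ.le
    have hg : Function.Injective fun s => (g s : W) := Subtype.val_injective.comp g.injective
    let i : I := ⟨(fun s => g s, fun s => f (g s)), hg, hf.comp hg, by
      refine hC.mono ?_ ?_
      · rintro _ ⟨s, rfl⟩
        exact (g s).2
      · rintro _ ⟨s, rfl⟩
        exact ⟨_, (g s).2, rfl⟩⟩
    have himage : (φ ⟨B i, mem_generatedField_of_range i⟩ : Set W) = i.1.2 '' b i := by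
      rw [hφ]
      exact Set.image_image _ _ _
    have hmem : i.1.2 '' b i ∈ L := himage ▸ (φ _).2
    obtain ⟨F, hF, hfin⟩ := finite_sdiff_of_countable_of_mem_generatedField
      exists_eq_preimage_fst_of_mem_branchCylinders hfib (fun j => (hbc j).image _) hmem
      ((hbc i).image _)
    refine (hbinf i).image i.2.2.1.injOn ?_
    refine (hfin.union (hF.biUnion fun j _ => ?_ :
      (⋃ j ∈ F, i.1.2 '' b i ∩ B j).Finite)).subset fun w hw => ?_
    · rcases eq_or_ne i j with rfl | hij
      · refine Set.finite_empty.subset ?_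
        rintro w ⟨h1, h2⟩
        exact Set.disjoint_left.1 i.2.2.2 (Set.image_subset_range _ _ h2)
          (Set.image_subset_range _ _ h1)
      · exact (hbad i j hij).subset
          (Set.inter_subset_inter Set.subset_union_right Set.subset_union_left)
    · rw [← Set.inter_iUnion₂, Set.sdiff_union_inter]
      exact hw
  · calc (2 : Cardinal.{u}) ^ μ < 2 ^ #Λ := hΛ ▸ hlam
      _ ≤ #(branchCylinders Λ M) := two_power_le_mk_branchCylinders
      _ ≤ #L := mk_le_of_injective (f := fun E => (⟨E, mem_generatedField_of_mem E.2⟩ : L))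
        fun E E' h => Subtype.ext (congrArg (fun c : L => (c : Set W)) h)
end

section
/- Assume GCH. If A is an infinite Boolean algebra whose cardinality |A| is a limit cardinal, then every dense subset of A has cardinality |A|. -/
universe u

open Cardinal

/-- In a Boolean algebra, an element is determined by the members of a dense set below it. -/
theorem le_of_forall_dense_le {A : Type u} [BooleanAlgebra A] {D : Set A}
    (hD₁ : ∀ d ∈ D, d ≠ ⊥) (hD₂ : ∀ a : A, a ≠ ⊥ → ∃ d ∈ D, d ≤ a) {a b : A}
    (h : ∀ d ∈ D, d ≤ a → d ≤ b) : a ≤ b := by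
  by_contra hab
  obtain ⟨d, hd, hle⟩ := hD₂ (a \ b) (mt sdiff_eq_bot_iff.mp hab)
  exact hD₁ d hd
    (disjoint_self.mp (disjoint_sdiff_self_left.mono hle (h d hd (hle.trans sdiff_le))))

/-- A Boolean algebra has at most as many elements as a dense set has subsets. -/
theorem mk_le_two_power_mk_dense {A : Type u} [BooleanAlgebra A] {D : Set A}
    (hD₁ : ∀ d ∈ D, d ≠ ⊥) (hD₂ : ∀ a : A, a ≠ ⊥ → ∃ d ∈ D, d ≤ a) :
    #A ≤ 2 ^ #D := by
  rw [← mk_set]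
  refine mk_le_of_injective (f := fun a : A => {d : D | (d : A) ≤ a}) fun a b hab => ?_
  have key (d : A) (hd : d ∈ D) : d ≤ a ↔ d ≤ b := Set.ext_iff.mp hab ⟨d, hd⟩
  exact le_antisymm (le_of_forall_dense_le hD₁ hD₂ fun d hd => (key d hd).mp)
    (le_of_forall_dense_le hD₁ hD₂ fun d hd => (key d hd).mpr)

theorem stmt_15 (gch : ∀ c : Cardinal.{u}, ℵ₀ ≤ c → 2 ^ c = Order.succ c)
    (A : Type u) [BooleanAlgebra A] [Infinite A]
    (h1 : ℵ₀ < #A) (h2 : ∀ ν : Cardinal.{u}, #A ≠ Order.succ ν)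
    (D : Set A) (hD₁ : ∀ d ∈ D, d ≠ ⊥)
    (hD₂ : ∀ a : A, a ≠ ⊥ → ∃ d ∈ D, d ≤ a) :
    #D = #A := by
  by_contra hne
  have hlt : #D < #A := (mk_set_le D).lt_of_ne hne
  have hle : #A ≤ 2 ^ #D := mk_le_two_power_mk_dense hD₁ hD₂
  rcases lt_or_ge #D ℵ₀ with hfin | hinf
  · exact (h1.trans_le hle).not_gt (power_lt_aleph0 (natCast_lt_aleph0 (n := 2)) hfin)
  · rw [gch _ hinf] at hle
    exact h2 _ (hle.antisymm (Order.succ_le_of_lt hlt))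
end

section
/- Let κ be an infinite cardinal and let D be a uniform ultrafilter on κ. Then for every cardinal θ there is a cardinal λ ≥ θ with λ^κ = λ for which there exists a system ⟨B_i : i < κ⟩ of Boolean algebras such that Length(B_i) ≤ λ for each i < κ, while Length(∏_{i<κ} B_i / D) = λ⁺. -/
universe u

open Cardinal Filter

variable {I : Type u}

/-- The equivalence `f ≡ g` iff `{i | f i = g i} ∈ D`. -/
def upSetoid (D : Ultrafilter I) (B : I → Type u) : Setoid (∀ i, B i) where
  r f g := ∀ᶠ i in (D : Filter I), f i = g i
  iseqv := by
    refine ⟨fun f => Eventually.of_forall fun i => rfl, fun h => ?_, fun h1 h2 => ?_⟩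
    · filter_upwards [h] with i e using e.symm
    · filter_upwards [h1, h2] with i e1 e2 using e1.trans e2

/-- The ultraproduct `∏_{i} B_i / D`: the quotient of the product by the congruence
`f ≡ g` iff `{i | f i = g i} ∈ D`. -/
def UProd (D : Ultrafilter I) (B : I → Type u) : Type u := Quotient (upSetoid D B)

namespace UProd

variable {D : Ultrafilter I} {B : I → Type u} [∀ i, BooleanAlgebra (B i)]

instance : PartialOrder (UProd D B) where
  le := Quotient.lift₂ (fun f g => ∀ᶠ i in (D : Filter I), f i ≤ g i)
    (by
      intro f g f' g' hf hg
      have hf' : ∀ᶠ i in (D : Filter I), f i = f' i := hf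
      have hg' : ∀ᶠ i in (D : Filter I), g i = g' i := hg
      refine propext ⟨fun h => ?_, fun h => ?_⟩
      · filter_upwards [h, hf', hg'] with i h1 h2 h3
        rw [← h2, ← h3]; exact h1
      · filter_upwards [h, hf', hg'] with i h1 h2 h3
        rw [h2, h3]; exact h1)
  le_refl := by
    rintro ⟨f⟩
    exact Eventually.of_forall fun i => le_refl _
  le_trans := by
    rintro ⟨f⟩ ⟨g⟩ ⟨h⟩ h1 h2
    have h1' : ∀ᶠ i in (D : Filter I), f i ≤ g i := h1
    have h2' : ∀ᶠ i in (D : Filter I), g i ≤ h i := h2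
    show ∀ᶠ i in (D : Filter I), f i ≤ h i
    filter_upwards [h1', h2'] with i e1 e2 using e1.trans e2
  le_antisymm := by
    rintro ⟨f⟩ ⟨g⟩ h1 h2
    have h1' : ∀ᶠ i in (D : Filter I), f i ≤ g i := h1
    have h2' : ∀ᶠ i in (D : Filter I), g i ≤ f i := h2
    exact Quotient.sound (by
      filter_upwards [h1', h2'] with i e1 e2 using le_antisymm e1 e2)

instance : Lattice (UProd D B) where
  sup := Quotient.map₂ (fun f g i => f i ⊔ g i) (by
    intro f f' hf g g' hg
    have hf' : ∀ᶠ i in (D : Filter I), f i = f' i := hf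
    have hg' : ∀ᶠ i in (D : Filter I), g i = g' i := hg
    show ∀ᶠ i in (D : Filter I), f i ⊔ g i = f' i ⊔ g' i
    filter_upwards [hf', hg'] with i e1 e2
    rw [e1, e2])
  inf := Quotient.map₂ (fun f g i => f i ⊓ g i) (by
    intro f f' hf g g' hg
    have hf' : ∀ᶠ i in (D : Filter I), f i = f' i := hf
    have hg' : ∀ᶠ i in (D : Filter I), g i = g' i := hg
    show ∀ᶠ i in (D : Filter I), f i ⊓ g i = f' i ⊓ g' i
    filter_upwards [hf', hg'] with i e1 e2
    rw [e1, e2])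
  le_sup_left := by
    rintro ⟨f⟩ ⟨g⟩
    show ∀ᶠ i in (D : Filter I), f i ≤ f i ⊔ g i
    exact Eventually.of_forall fun i => le_sup_left
  le_sup_right := by
    rintro ⟨f⟩ ⟨g⟩
    show ∀ᶠ i in (D : Filter I), g i ≤ f i ⊔ g i
    exact Eventually.of_forall fun i => le_sup_right
  sup_le := by
    rintro ⟨f⟩ ⟨g⟩ ⟨h⟩ h1 h2
    have h1' : ∀ᶠ i in (D : Filter I), f i ≤ h i := h1
    have h2' : ∀ᶠ i in (D : Filter I), g i ≤ h i := h2
    show ∀ᶠ i in (D : Filter I), f i ⊔ g i ≤ h i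
    filter_upwards [h1', h2'] with i e1 e2 using sup_le e1 e2
  inf_le_left := by
    rintro ⟨f⟩ ⟨g⟩
    show ∀ᶠ i in (D : Filter I), f i ⊓ g i ≤ f i
    exact Eventually.of_forall fun i => inf_le_left
  inf_le_right := by
    rintro ⟨f⟩ ⟨g⟩
    show ∀ᶠ i in (D : Filter I), f i ⊓ g i ≤ g i
    exact Eventually.of_forall fun i => inf_le_right
  le_inf := by
    rintro ⟨f⟩ ⟨g⟩ ⟨h⟩ h1 h2
    have h1' : ∀ᶠ i in (D : Filter I), f i ≤ g i := h1
    have h2' : ∀ᶠ i in (D : Filter I), f i ≤ h i := h2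
    show ∀ᶠ i in (D : Filter I), f i ≤ g i ⊓ h i
    filter_upwards [h1', h2'] with i e1 e2 using le_inf e1 e2

instance : DistribLattice (UProd D B) where
  le_sup_inf := by
    rintro ⟨f⟩ ⟨g⟩ ⟨h⟩
    show ∀ᶠ i in (D : Filter I), (f i ⊔ g i) ⊓ (f i ⊔ h i) ≤ f i ⊔ g i ⊓ h i
    exact Eventually.of_forall fun i => le_sup_inf

noncomputable instance : BooleanAlgebra (UProd D B) where
  compl := Quotient.map (fun f i => (f i)ᶜ) (by
    intro f f' hf
    have hf' : ∀ᶠ i in (D : Filter I), f i = f' i := hf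
    show ∀ᶠ i in (D : Filter I), (f i)ᶜ = (f' i)ᶜ
    filter_upwards [hf'] with i e
    rw [e])
  top := Quotient.mk _ (fun _ => ⊤)
  bot := Quotient.mk _ (fun _ => ⊥)
  le_top := by
    rintro ⟨f⟩
    show ∀ᶠ i in (D : Filter I), f i ≤ ⊤
    exact Eventually.of_forall fun i => le_top
  bot_le := by
    rintro ⟨f⟩
    show ∀ᶠ i in (D : Filter I), ⊥ ≤ f i
    exact Eventually.of_forall fun i => bot_le
  inf_compl_le_bot := by
    rintro ⟨f⟩
    show ∀ᶠ i in (D : Filter I), f i ⊓ (f i)ᶜ ≤ ⊥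
    exact Eventually.of_forall fun i => by simp
  top_le_sup_compl := by
    rintro ⟨f⟩
    show ∀ᶠ i in (D : Filter I), ⊤ ≤ f i ⊔ (f i)ᶜ
    exact Eventually.of_forall fun i => by simp

end UProd

/-- The length of a Boolean algebra: the supremum of the cardinalities of chains. -/
noncomputable def lengthBA (A : Type u) [BooleanAlgebra A] : Cardinal.{u} :=
  sSup {μ : Cardinal.{u} | ∃ C : Set A, IsChain (· ≤ ·) C ∧ #C = μ}

namespace Cardinal

theorem mk_sigma_le_of_le {ι : Type u} {A : ι → Type u} {c : Cardinal.{u}} (hc : ℵ₀ ≤ c)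
    (hι : #ι ≤ c) (hA : ∀ i, #(A i) ≤ c) : #(Σ i, A i) ≤ c := by
  rw [mk_sigma]
  calc Cardinal.sum (fun i => #(A i)) ≤ Cardinal.sum (fun _ : ι => c) := sum_le_sum _ _ hA
    _ = #ι * c := by simp
    _ ≤ c * c := by gcongr
    _ = c := mul_eq_self hc

/-- Pigeonhole principle: a map from a large type to a small one has a large fibre. -/
theorem exists_lt_mk_fiber {α A : Type u} {c : Cardinal.{u}} (hc : ℵ₀ ≤ c) (φ : α → A)
    (hA : #A ≤ c) (hα : c < #α) : ∃ a, c < #{x | φ x = a} := by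
  by_contra! h
  refine hα.not_ge ?_
  rw [← mk_congr (Equiv.sigmaFiberEquiv φ)]
  exact mk_sigma_le_of_le hc hA h

theorem exists_lt_mk_fiber_of_lt_mk_set {α A : Type u} {c : Cardinal.{u}} (hc : ℵ₀ ≤ c)
    (φ : α → A) (hA : #A ≤ c) {s : Set α} (hs : c < #s) : ∃ a, c < #{x ∈ s | φ x = a} := by
  obtain ⟨a, ha⟩ := exists_lt_mk_fiber hc (fun x : s => φ x) hA hs
  refine ⟨a, ha.trans_le ?_⟩
  refine mk_le_of_injective (f := fun x => ⟨x.1.1, x.1.2, x.2⟩) ?_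
  intro x y h
  simpa [Subtype.ext_iff] using h

section Bounded

variable {P : Type u} [LinearOrder P] {c : Cardinal.{u}}

/-- In a linear order of cardinality greater than `c` whose initial segments have cardinality at
most `c`, families of size at most `c` are strictly bounded. -/
theorem exists_forall_lt_of_mk_le (hc : ℵ₀ ≤ c) (hP : ∀ a : P, #(Set.Iic a) ≤ c) (hcP : c < #P)
    {ι : Type u} (hι : #ι ≤ c) (r : ι → P) : ∃ b, ∀ i, r i < b := by
  by_contra! h
  choose i hi using h
  refine hcP.not_ge ((mk_le_of_injective (f := fun b => (⟨i b, b, hi b⟩ :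
    Σ i, Set.Iic (r i))) ?_).trans (mk_sigma_le_of_le hc hι fun i => hP (r i)))
  intro a b hab
  have : ∀ x y : (Σ i, Set.Iic (r i)), x = y → x.2.1 = y.2.1 := by
    rintro x _ rfl
    rfl
  exact this _ _ hab

theorem exists_ge_of_lt_mk (hP : ∀ a : P, #(Set.Iic a) ≤ c) {s : Set P} (hs : c < #s) (a : P) :
    ∃ b ∈ s, a < b := by
  by_contra! h
  exact hs.not_ge ((mk_le_mk_of_subset fun b hb => h b hb).trans (hP a))

theorem mk_arrow_le_of_bounded {I X : Type u} {d : Cardinal.{u}} (hc : ℵ₀ ≤ c)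
    (hP : ∀ a : P, #(Set.Iic a) ≤ c) (hcP : c < #P) (hI : #I ≤ c) (r : X → P) (hd : ℵ₀ ≤ d)
    (hPd : #P ≤ d) (hX : ∀ w, #(I → {x // r x ≤ w}) ≤ d) : #(I → X) ≤ d := by
  have hb : ∀ f : I → X, ∃ b, ∀ i, r (f i) < b :=
    fun f => exists_forall_lt_of_mk_le hc hP hcP hI fun i => r (f i)
  choose b hb using hb
  refine (mk_le_of_injective (f := fun f => (⟨b f, fun i => ⟨f i, (hb f i).le⟩⟩ :
    Σ w, (I → {x // r x ≤ w}))) ?_).trans (mk_sigma_le_of_le hd hPd hX)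
  intro f g hfg
  have : ∀ x y : (Σ w, (I → {x // r x ≤ w})), x = y → ∀ i, (x.2 i).1 = (y.2 i).1 := by
    rintro x _ rfl _
    rfl
  exact funext (this _ _ hfg)

theorem exists_wellOrder_mk_eq_succ (hc : ℵ₀ ≤ c) :
    ∃ (W : Type u) (_ : LinearOrder W) (_ : WellFoundedLT W),
      #W = Order.succ c ∧ ∀ a : W, #(Set.Iic a) ≤ c := by
  refine ⟨(Order.succ c).ord.ToType, inferInstance, inferInstance, by simp, fun a => ?_⟩
  have h := mk_Iic_lt a (by simp) (by simpa using hc.trans (Order.le_succ c))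
  simpa using h

/-- There are arbitrarily large `l = ∑ w, μ w` such that `μ` is a sequence of length `κ⁺` of
regular cardinals in which every term exceeds the sum of the previous ones. -/
theorem exists_fast_sequence {κ : Cardinal.{u}} (hκ : ℵ₀ ≤ κ) (θ : Cardinal.{u}) (W : Type u)
    [LinearOrder W] [WellFoundedLT W] (hW : #W = Order.succ κ)
    (hWκ : ∀ a : W, #(Set.Iic a) ≤ κ) :
    ∃ (l : Cardinal.{u}) (μ : W → Cardinal.{u}), θ ≤ l ∧ Order.succ κ < l ∧
      2 ^ Order.succ κ ≤ l ∧ l ^ κ = l ∧ l ≤ Cardinal.sum μ ∧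
      (∀ w, (μ w).IsRegular) ∧ (∀ w, Order.succ κ < μ w) ∧ (∀ w, 2 ^ μ w ≤ l) ∧ StrictMono μ ∧
      ∀ w, Cardinal.sum (fun v : Set.Iio w => μ v) < μ w := by
  set B : Cardinal.{u} := max θ (2 ^ Order.succ κ)
  let μ : W → Cardinal.{u} := WellFoundedLT.fix fun w ih =>
    Order.succ (2 ^ max B (Cardinal.sum fun v : Set.Iio w => ih v v.2))
  have hμ : ∀ w, μ w = Order.succ (2 ^ max B (Cardinal.sum fun v : Set.Iio w => μ v)) :=
    fun w => WellFoundedLT.fix_eq _ w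
  have hκ' : ℵ₀ ≤ Order.succ κ := hκ.trans (Order.le_succ κ)
  have hBκ : Order.succ κ < B :=
    (cantor _).trans_le (le_max_right _ _)
  have hBμ : ∀ w, B < μ w := fun w => by
    rw [hμ]
    exact ((le_max_left _ _).trans (cantor _).le).trans_lt (Order.lt_succ _)
  have hsum : ∀ w, Cardinal.sum (fun v : Set.Iio w => μ v) < μ w := fun w => by
    conv_rhs => rw [hμ]
    exact ((le_max_right _ _).trans (cantor _).le).trans_lt (Order.lt_succ _)
  have hpow : ∀ v w, v < w → 2 ^ μ v < μ w := fun v w h => by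
    conv_rhs => rw [hμ]
    refine (power_le_power_left two_ne_zero ?_).trans_lt (Order.lt_succ _)
    exact (le_sum (fun v : Set.Iio w => μ v) ⟨v, h⟩).trans (le_max_right _ _)
  have hmono : StrictMono μ := fun v w h => (cantor _).trans (hpow v w h)
  have hle : ∀ w, μ w ≤ Cardinal.sum μ := le_sum μ
  have hcW : κ < #W := hW ▸ Order.lt_succ κ
  have hnext : ∀ w : W, ∃ w', w < w' := fun w => by
    obtain ⟨b, hb⟩ := exists_forall_lt_of_mk_le hκ hWκ hcW (ι := PUnit)
      (by simpa using one_le_aleph0.trans hκ) fun _ => w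
    exact ⟨b, hb ⟨⟩⟩
  have h2l : ∀ w, 2 ^ μ w ≤ Cardinal.sum μ := fun w => by
    obtain ⟨w', h⟩ := hnext w
    exact (hpow w w' h).le.trans (hle w')
  obtain ⟨w₀⟩ : Nonempty W := by
    rw [← mk_ne_zero_iff, hW]
    exact (aleph0_pos.trans_le hκ').ne'
  have hBl : B ≤ Cardinal.sum μ := (hBμ w₀).le.trans (hle w₀)
  have hκμ : ∀ w, Order.succ κ < μ w := fun w => hBκ.trans (hBμ w)
  refine ⟨Cardinal.sum μ, μ, (le_max_left _ _).trans hBl, hBκ.trans_le hBl,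
    (le_max_right _ _).trans hBl, ?_, le_rfl, fun w => ?_, hκμ, h2l, hmono, hsum⟩
  · refine le_antisymm ?_ (self_le_power _ (one_le_aleph0.trans hκ))
    have key := mk_arrow_le_of_bounded (I := κ.out) (X := Σ w, (μ w).out) (d := Cardinal.sum μ)
      hκ hWκ hcW (by simp) (fun x => x.1) (hκ'.trans (hBκ.trans_le hBl).le)
      (hW ▸ (hBκ.trans_le hBl).le) fun w => ?_
    · simpa [mk_sigma] using key
    · have h1 : #{x : Σ w, (μ w).out // x.1 ≤ w} ≤ μ w := by
        have h2 : #(Σ v : Set.Iic w, (μ v).out) ≤ μ w :=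
          mk_sigma_le_of_le (hκ'.trans (hκμ w).le)
            ((hWκ w).trans ((Order.le_succ κ).trans (hκμ w).le))
            fun v => by simpa using hmono.monotone v.2
        refine (mk_le_of_injective (f := fun x => (⟨⟨x.1.1, x.2⟩, x.1.2⟩ :
          Σ v : Set.Iic w, (μ v).out)) ?_).trans h2
        rintro ⟨⟨a, b⟩, h⟩ ⟨⟨a', b'⟩, h'⟩ e
        simp only [Sigma.mk.injEq] at e
        obtain rfl : a = a' := congrArg Subtype.val e.1
        simpa using e.2
      have h3 : κ ≤ μ w := (Order.le_succ κ).trans (hκμ w).le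
      calc #(κ.out → {x : Σ w, (μ w).out // x.1 ≤ w})
          = #{x : Σ w, (μ w).out // x.1 ≤ w} ^ κ := by simp
        _ ≤ μ w ^ κ := power_le_power_right h1
        _ ≤ μ w ^ μ w := power_le_power_left (aleph0_pos.trans_le (hκ.trans h3)).ne' h3
        _ = 2 ^ μ w := power_self_eq (hκ.trans h3)
        _ ≤ _ := h2l w
  · rw [hμ]
    exact isRegular_succ
      ((hκ'.trans hBκ.le).trans ((le_max_left _ _).trans (cantor _).le))

end Bounded

end Cardinal

namespace Filter

section ExactBound

variable {P W : Type u} [LinearOrder P] {c : Cardinal.{u}}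
  {F : Filter W} {f : P → W → Ordinal.{u}}

theorem exists_next_bound (hP : ∀ a : P, #(Set.Iic a) ≤ c) (hcP : c < #P)
    (hc : 2 ^ #W ≤ c) (hW : ℵ₀ ≤ #W)
    (hf : ∀ a b, a < b → ∀ᶠ w in F, f a w < f b w) (M : W → Ordinal.{u})
    (hM : ∀ a w, f a w ≤ M w)
    (hg : ∀ g : W → Ordinal.{u}, (∀ a, ∀ᶠ w in F, f a w < g w) →
      ∃ h : W → Ordinal.{u}, (∃ᶠ w in F, h w < g w) ∧
        ∀ a, ∃ b ≥ a, ∀ᶠ w in F, h w < g w → f b w ≤ h w)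
    {ι : Type u} (hι : #ι ≤ #W) (s : ι → W → Ordinal.{u}) :
    ∃ (h : W → Ordinal.{u}) (a₀ : P), ∀ a ≥ a₀, ∃ w, f a w ≤ h w ∧
      ∀ j, f a w ≤ s j w → h w < s j w := by
  let t : Option ι → W → Ordinal.{u} := fun o => o.elim M s
  have hmin : ∀ a w, ∃ j, f a w ≤ t j w ∧ ∀ j', f a w ≤ t j' w → t j w ≤ t j' w := by
    intro a w
    have hne : {o | ∃ j, f a w ≤ t j w ∧ t j w = o}.Nonempty := ⟨M w, none, hM a w, rfl⟩
    obtain ⟨j, hj, hj'⟩ := csInf_mem hne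
    exact ⟨j, hj, fun j' h => hj' ▸ csInf_le' ⟨j', h, rfl⟩⟩
  choose φ hφ hφmin using hmin
  have hc0 : ℵ₀ ≤ c := hW.trans ((cantor _).le.trans hc)
  have hcard : #(W → Option ι) ≤ c := by
    refine le_trans ?_ hc
    rw [← power_self_eq hW]
    have h1 : #(Option ι) ≤ #W := by
      rw [mk_option]
      exact add_le_of_le hW hι (one_le_aleph0.trans hW)
    simpa using power_le_power_right h1
  obtain ⟨ψ, hψ⟩ := exists_lt_mk_fiber hc0 φ hcard hcP
  obtain ⟨h, hfreq, hbd⟩ := hg (fun w => t (ψ w) w) fun a => by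
    obtain ⟨b, hb, hab⟩ := exists_ge_of_lt_mk hP hψ a
    filter_upwards [hf a b hab] with w hw
    have hb' : φ b = ψ := hb
    exact hw.trans_le (hb' ▸ hφ b w)
  obtain ⟨a₀, ha₀⟩ : {a | φ a = ψ}.Nonempty := by
    rw [Set.nonempty_iff_ne_empty]
    rintro h
    simp [h] at hψ
  have hle : ∀ a b, a ≤ b → ∀ᶠ w in F, f a w ≤ f b w := fun a b hab => by
    rcases hab.eq_or_lt with rfl | hab
    · exact Eventually.of_forall fun _ => le_rfl
    · exact (hf a b hab).mono fun _ => le_of_lt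
  refine ⟨h, a₀, fun a ha => ?_⟩
  obtain ⟨b, hb, hb'⟩ := hbd a
  obtain ⟨w, hw, h1, h2, h3⟩ := (hfreq.and_eventually
    (hb'.and ((hle a b hb).and (hle a₀ a ha)))).exists
  refine ⟨w, h2.trans (h1 hw), fun j hj => hw.trans_le ?_⟩
  have ha₀' : φ a₀ = ψ := ha₀
  exact ha₀' ▸ hφmin a₀ w (some j) (h3.trans hj)

/-- A sequence of ordinal-valued functions on `W` that increases modulo a filter and is longer than
`2 ^ #W` has an exact upper bound modulo that filter. -/
theorem exists_exact_upper_bound (hP : ∀ a : P, #(Set.Iic a) ≤ c) (hcP : c < #P)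
    (hc : 2 ^ #W ≤ c) (hW : ℵ₀ ≤ #W)
    (hf : ∀ a b, a < b → ∀ᶠ w in F, f a w < f b w) (M : W → Ordinal.{u})
    (hM : ∀ a w, f a w ≤ M w) :
    ∃ g : W → Ordinal.{u}, (∀ a, ∀ᶠ w in F, f a w < g w) ∧
      ∀ h : W → Ordinal.{u}, (∃ᶠ w in F, h w < g w) →
        ∃ a, ∀ b ≥ a, ¬ ∀ᶠ w in F, h w < g w → f b w ≤ h w := by
  by_contra! hg
  obtain ⟨Ξ, _, _, hΞ, hΞW⟩ := exists_wellOrder_mk_eq_succ hW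
  have step := fun (ξ : Ξ) => exists_next_bound hP hcP hc hW hf M hM hg (ι := Set.Iio ξ)
    ((mk_le_mk_of_subset Set.Iio_subset_Iic_self).trans (hΞW ξ))
  choose H A hA using step
  let h : Ξ → W → Ordinal.{u} := WellFoundedLT.fix fun ξ ih => H ξ fun ζ => ih ζ ζ.2
  have hh : ∀ ξ, h ξ = H ξ fun ζ => h ζ := fun ξ => WellFoundedLT.fix_eq _ ξ
  have hc0 : ℵ₀ ≤ c := hW.trans ((cantor _).le.trans hc)
  obtain ⟨a, ha⟩ := exists_forall_lt_of_mk_le hc0 hP hcP (ι := Ξ)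
    (hΞ ▸ (Order.succ_le_of_lt (cantor _)).trans hc) fun ξ => A ξ fun ζ => h ζ
  have hw := fun ξ => hA ξ (fun ζ => h ζ) a (ha ξ).le
  choose w hw1 hw2 using hw
  simp only [← hh] at hw1 hw2
  obtain ⟨v, hv⟩ := exists_lt_mk_fiber hW w le_rfl (hΞ ▸ Order.lt_succ _)
  have hanti : StrictAnti fun ξ : {ξ | w ξ = v} => h ξ v := by
    rintro ⟨ξ, hξ⟩ ⟨ζ, hζ⟩ hlt
    have hξ' : w ξ = v := hξ
    have hζ' : w ζ = v := hζ
    have := hw2 ζ ⟨ξ, hlt⟩ (by rw [hζ', ← hξ']; exact hw1 ξ)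
    rwa [hζ'] at this
  have := hanti.wellFoundedGT
  have hfin := Finite.of_wellFoundedLT_wellFoundedGT {ξ | w ξ = v}
  exact (hW.trans hv.le).not_gt (lt_aleph0_of_finite _)

end ExactBound

end Filter

namespace Filter

/-- Below an exact upper bound `g` of a long sequence, small families of ordinals are eventually
not cofinal in `g w`. -/
theorem eventually_exists_bound_of_exact {P W T : Type u} [LinearOrder P] [Nonempty T]
    {c : Cardinal.{u}} {F : Filter W} {f : P → W → Ordinal.{u}} {g : W → Ordinal.{u}}
    (hP : ∀ a : P, #(Set.Iic a) ≤ c) (hcP : c < #P) (hc : ℵ₀ ≤ c) (hT : #(W → T) ≤ c)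
    (hub : ∀ a, ∀ᶠ w in F, f a w < g w)
    (hex : ∀ h : W → Ordinal.{u}, (∃ᶠ w in F, h w < g w) →
      ∃ a, ∀ b ≥ a, ¬ ∀ᶠ w in F, h w < g w → f b w ≤ h w) :
    ∀ᶠ w in F, ∀ e : T → Ordinal.{u}, ∃ β < g w, ∀ t, e t < g w → e t < β := by
  classical
  by_contra hK
  let K : W → Prop := fun w => ∃ e : T → Ordinal.{u}, ∀ β < g w, ∃ t, β ≤ e t ∧ e t < g w
  have hK' : ∃ᶠ w in F, K w := by
    refine (not_eventually.1 hK).mono fun w hw => ?_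
    push Not at hw
    obtain ⟨e, he⟩ := hw
    refine ⟨e, fun β hβ => ?_⟩
    obtain ⟨t, h1, h2⟩ := he β hβ
    exact ⟨t, h2, h1⟩
  have he : ∀ w, ∃ e : T → Ordinal.{u}, K w → ∀ β < g w, ∃ t, β ≤ e t ∧ e t < g w := fun w => by
    by_cases h : K w
    · exact ⟨h.choose, fun _ => h.choose_spec⟩
    · exact ⟨fun _ => 0, fun h' => absurd h' h⟩
  choose e he using he
  have hφ : ∀ a w, ∃ t, K w → f a w < g w → f a w ≤ e w t ∧ e w t < g w := fun a w => by
    by_cases h : K w ∧ f a w < g w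
    · obtain ⟨t, ht⟩ := he w h.1 _ h.2
      exact ⟨t, fun _ _ => ht⟩
    · exact ⟨Classical.arbitrary T, fun h1 h2 => absurd ⟨h1, h2⟩ h⟩
  choose φ hφ using hφ
  obtain ⟨u, hu⟩ := exists_lt_mk_fiber hc φ hT hcP
  have hua : ∀ a : P, ∃ b > a, φ b = u := fun a => by
    obtain ⟨b, hb, hab⟩ := exists_ge_of_lt_mk hP hu a
    exact ⟨b, hab, hb⟩
  have hne : Nonempty P := by
    rw [← mk_ne_zero_iff]
    rintro h
    simp [h] at hcP
  obtain ⟨a₀, -, ha₀⟩ := hua hne.some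
  obtain ⟨a, ha⟩ := hex (fun w => if K w then e w (u w) else g w) <| by
    refine (hK'.and_eventually (hub a₀)).mono fun w hw => ?_
    have := (hφ a₀ w hw.1 hw.2).2
    rw [ha₀] at this
    simpa [hw.1] using this
  obtain ⟨b, hb, hbu⟩ := hua a
  refine ha b hb.le ?_
  filter_upwards [hub b] with w hw hlt
  by_cases h : K w
  · have := (hφ b w h hw).1
    rw [hbu] at this
    simpa [h] using this
  · simp [h] at hlt

/-- Fewer than `(∑ w, μ w)⁺` functions in `∏ w, μ w` have a common upper bound modulo small sets. -/
theorem exists_eventually_bound {κ : Cardinal.{u}} (hκ : ℵ₀ ≤ κ) {W : Type u} [LinearOrder W]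
    (hWκ : ∀ a : W, #(Set.Iic a) ≤ κ) {μ : W → Cardinal.{u}} (hreg : ∀ w, (μ w).IsRegular)
    (hsum : ∀ w, Cardinal.sum (fun v : Set.Iio w => μ v) < μ w)
    {ι : Type u} (hι : #ι ≤ Cardinal.sum μ) (y : ι → W → Ordinal.{u})
    (hy : ∀ j w, y j w < (μ w).ord) :
    ∃ z : W → Ordinal.{u}, (∀ w, z w < (μ w).ord) ∧
      ∀ j, ∀ᶠ w in cocardinal W (isRegular_succ hκ), y j w < z w := by
  obtain ⟨i⟩ : #ι ≤ #(Σ w, (μ w).out) := by simpa [mk_sigma] using hι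
  refine ⟨fun w => ⨆ j : {j // (i j).1 < w}, y j w + 1, fun w => ?_, fun j => ?_⟩
  · refine Ordinal.iSup_add_one_lt_of_lt_cof ?_ fun j => hy j w
    rw [(hreg w).cof_ord]
    refine lt_of_le_of_lt ?_ (hsum w)
    have h : #(Σ v : Set.Iio w, (μ v).out) = Cardinal.sum (fun v : Set.Iio w => μ v) := by
      simp [mk_sigma]
    rw [← h]
    refine mk_le_of_injective (f := fun j => ⟨⟨(i j.1).1, j.2⟩, (i j.1).2⟩) fun a b hab => ?_
    have : ∀ x y : (Σ v : Set.Iio w, (μ v).out), x = y →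
        (⟨x.1.1, x.2⟩ : Σ w, (μ w).out) = ⟨y.1.1, y.2⟩ := by
      rintro x _ rfl
      rfl
    exact Subtype.ext (i.injective (this _ _ hab))
  · rw [eventually_cocardinal, Order.lt_succ_iff]
    refine (mk_le_mk_of_subset fun w hw => ?_).trans (hWκ (i j).1)
    by_contra h
    exact hw (Ordinal.lt_iSup_add_one (fun j : {j // (i j).1 < w} => y j w) ⟨j, not_le.1 h⟩)

/-- Recursive construction of a long sequence in `∏ w, μ w` increasing modulo small sets. -/
theorem exists_increasing_sequence {κ : Cardinal.{u}} (hκ : ℵ₀ ≤ κ) {W P : Type u} [LinearOrder W]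
    (hWκ : ∀ a : W, #(Set.Iic a) ≤ κ) {μ : W → Cardinal.{u}} (hreg : ∀ w, (μ w).IsRegular)
    (hsum : ∀ w, Cardinal.sum (fun v : Set.Iio w => μ v) < μ w)
    [LinearOrder P] [WellFoundedLT P] (hP : ∀ a : P, #(Set.Iic a) ≤ Cardinal.sum μ) :
    ∃ f : P → W → Ordinal.{u}, (∀ a w, f a w < (μ w).ord) ∧
      ∀ a b, a < b → ∀ᶠ w in cocardinal W (isRegular_succ hκ), f a w < f b w := by
  have hstep : ∀ (a : P) (y : Set.Iio a → {z : W → Ordinal.{u} // ∀ w, z w < (μ w).ord}),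
      ∃ z : {z : W → Ordinal.{u} // ∀ w, z w < (μ w).ord},
        ∀ j, ∀ᶠ w in cocardinal W (isRegular_succ hκ), (y j).1 w < z.1 w := fun a y => by
    obtain ⟨z, hz, hz'⟩ := exists_eventually_bound hκ hWκ hreg hsum
      ((mk_le_mk_of_subset Set.Iio_subset_Iic_self).trans (hP a)) (fun j => (y j).1)
      fun j => (y j).2
    exact ⟨⟨z, hz⟩, hz'⟩
  choose G hG using hstep
  let f : P → {z : W → Ordinal.{u} // ∀ w, z w < (μ w).ord} :=
    WellFoundedLT.fix fun a ih => G a fun j => ih j.1 j.2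
  refine ⟨fun a => (f a).1, fun a => (f a).2, fun a b hab => ?_⟩
  have h : f b = G b fun j => f j.1 := WellFoundedLT.fix_eq _ b
  show ∀ᶠ w in _, (f a).1 w < (f b).1 w
  rw [h]
  exact hG b (fun j => f j.1) ⟨a, hab⟩

end Filter

namespace Filter

theorem exists_nodes {W L : Type u} [Preorder W] (m : Cardinal.{u}) (hm : ℵ₀ ≤ m) (ξ : W)
    (hξ : #(Set.Iic ξ) ≤ m) (y : L → W → Ordinal.{u}) (hy : ∀ a, ∀ ζ ≤ ξ, y a ζ < m.ord) :
    ∃ (N : Type u) (nd : L → N), Nonempty N ∧ #N ≤ 2 ^ m ∧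
      ∀ a b, nd a = nd b ↔ ∀ ζ ≤ ξ, y a ζ = y b ζ := by
  refine ⟨Set.Iic ξ → m.ord.ToType, fun a ζ => Ordinal.ToType.mk ⟨y a ζ, hy a ζ ζ.2⟩, ?_, ?_,
    fun a b => ?_⟩
  · have : m.ord ≠ 0 := by
      rw [Ne, ord_eq_zero]
      exact (aleph0_pos.trans_le hm).ne'
    have : Nonempty m.ord.ToType := Ordinal.nonempty_toType_iff.2 this
    infer_instance
  · have h : #(Set.Iic ξ → m.ord.ToType) = m ^ #(Set.Iic ξ) := by simp
    rw [h, ← power_self_eq hm]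
    exact power_le_power_left (aleph0_pos.trans_le hm).ne' hξ
  · simp only [funext_iff, EmbeddingLike.apply_eq_iff_eq, Subtype.forall, Set.mem_Iic]
    exact forall₂_congr fun ζ h => Subtype.ext_iff

/-- There are arbitrarily large `l = l ^ κ` with `l⁺` branches of a tree of height `κ⁺` and width
`l`, such that any more than `l` of the branches split at all but `κ` many levels. -/
theorem exists_splitting_family {κ : Cardinal.{u}} (hκ : ℵ₀ ≤ κ) (θ : Cardinal.{u}) :
    ∃ l : Cardinal.{u}, θ ≤ l ∧ l ^ κ = l ∧ Order.succ κ < l ∧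
      ∃ (W L : Type u) (_ : LinearOrder W) (_ : WellFoundedLT W) (_ : LinearOrder L)
        (N : W → Type u) (nd : ∀ ξ, L → N ξ) (x : L → W → Ordinal.{u}),
        #W = Order.succ κ ∧ #L = Order.succ l ∧ (∀ a : L, #(Set.Iic a) ≤ l) ∧
        (∀ ξ, #(N ξ) ≤ l) ∧ (∀ ξ a b, nd ξ a = nd ξ b ↔ ∀ ζ ≤ ξ, x a ζ = x b ζ) ∧
        Function.Injective x ∧
        ∀ X : Set L, l < #X →
          #{ξ | ¬ ∃ a ∈ X, ∃ b ∈ X, (∀ ζ < ξ, x a ζ = x b ζ) ∧ x a ξ ≠ x b ξ} ≤ κ := by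
  classical
  obtain ⟨W, _, _, hW, hWκ⟩ := exists_wellOrder_mk_eq_succ hκ
  obtain ⟨l, μ, hθ, hκl, h2l, hl, hlμ, hreg, hκμ, hμl, hmono, hsum⟩ :=
    exists_fast_sequence hκ θ W hW hWκ
  have hl0 : ℵ₀ ≤ l := (hκ.trans (Order.le_succ κ)).trans hκl.le
  obtain ⟨L, _, _, hL, hLl⟩ := exists_wellOrder_mk_eq_succ hl0
  have hlL : l < #L := hL ▸ Order.lt_succ l
  obtain ⟨f, hfμ, hf⟩ := exists_increasing_sequence (P := L) hκ hWκ hreg hsum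
    fun a => (hLl a).trans hlμ
  obtain ⟨g, hub, hex⟩ := exists_exact_upper_bound hLl hlL (hW ▸ h2l)
    (hW ▸ hκ.trans (Order.le_succ κ)) hf (fun w => (μ w).ord) fun a w => (hfμ a w).le
  have hlt : ∀ {ζ v}, ζ ≤ v → ∀ a, f a ζ < (μ v).ord := fun h a =>
    (hfμ a _).trans_le (ord_le_ord.2 (hmono.monotone h))
  have hnode := fun v => exists_nodes (μ v) (hreg v).aleph0_le v
    ((hWκ v).trans ((Order.le_succ κ).trans (hκμ v).le)) f fun a ζ h => hlt h a
  choose N₀ nd₀ hN₀ hN₀μ hnd₀ using hnode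
  have hq : ∀ v, ∃ q > v, ∀ w ≥ q, ∀ e : N₀ v → Ordinal.{u},
      ∃ β < g w, ∀ t, e t < g w → e t < β := fun v => by
    have hT : #(W → N₀ v) ≤ l := by
      rw [← power_def, hW]
      refine (power_le_power_right (hN₀μ v)).trans ?_
      rw [← power_mul, mul_eq_left (hreg v).aleph0_le (hκμ v).le (Order.succ_ne_bot κ)]
      exact hμl v
    have h := eventually_exists_bound_of_exact hLl hlL hl0 hT hub hex
    rw [eventually_cocardinal, Order.lt_succ_iff] at h
    obtain ⟨q, hq⟩ := exists_forall_lt_of_mk_le hκ hWκ (hW ▸ Order.lt_succ κ)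
      (ι := Option {w | ¬ ∀ e : N₀ v → Ordinal.{u}, ∃ β < g w, ∀ t, e t < g w → e t < β})
      (by
        rw [mk_option]
        exact add_le_of_le hκ h (one_le_aleph0.trans hκ))
      (fun o => o.elim v fun w => w.1)
    refine ⟨q, hq none, fun w hw => ?_⟩
    by_contra hcon
    exact hw.not_gt (hq (some ⟨w, hcon⟩))
  choose q hqv hq using hq
  have hstep : ∀ (ξ : W) (k : Set.Iio ξ → W), ∃ v, ∀ ζ, k ζ < v := fun ξ k =>
    exists_forall_lt_of_mk_le hκ hWκ (hW ▸ Order.lt_succ κ)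
      ((mk_le_mk_of_subset Set.Iio_subset_Iic_self).trans (hWκ ξ)) k
  choose V hV using hstep
  let k : W → W := WellFoundedLT.fix fun ξ ih => q (V ξ fun ζ => ih ζ.1 ζ.2)
  have hk : ∀ ξ, k ξ = q (V ξ fun ζ => k ζ.1) := fun ξ => WellFoundedLT.fix_eq _ ξ
  have hkv : ∀ ζ ξ, ζ < ξ → k ζ < V ξ fun ζ => k ζ.1 := fun ζ ξ h =>
    hV ξ (fun ζ => k ζ.1) ⟨ζ, h⟩
  have hkm : StrictMono k := fun ζ ξ h => by
    rw [hk ξ]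
    exact (hkv ζ ξ h).trans (hqv _)
  have hnode := fun ξ => exists_nodes (μ (k ξ)) (hreg (k ξ)).aleph0_le ξ
    ((hWκ ξ).trans ((Order.le_succ κ).trans (hκμ (k ξ)).le)) (fun a ξ => f a (k ξ))
    fun a ζ h => hlt (hkm.monotone h) a
  choose N nd hN hNμ hnd using hnode
  refine ⟨l, hθ, hl, hκl, W, L, _, ‹_›, _, N, nd, fun a ξ => f a (k ξ), hW, hL, hLl,
    fun ξ => (hNμ ξ).trans (hμl _), hnd, ?_, fun X hX => ?_⟩
  · refine Function.Injective.of_lt_imp_ne fun a b hab heq => ?_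
    have h := hf a b hab
    rw [eventually_cocardinal] at h
    refine h.not_ge ?_
    rw [← hW]
    refine mk_le_of_injective (f := fun ξ => ⟨k ξ, ?_⟩) fun ζ ξ h => hkm.injective ?_
    · exact (congrFun heq ξ).not_lt
    · exact congrArg Subtype.val h
  · by_contra hZ
    set Z := {ξ | ¬ ∃ a ∈ X, ∃ b ∈ X, (∀ ζ < ξ, f a (k ζ) = f b (k ζ)) ∧ f a (k ξ) ≠ f b (k ξ)}
    have hβ : ∀ ξ, ∃ β, ξ ∈ Z → β < g (k ξ) ∧ ∀ a ∈ X, f a (k ξ) < g (k ξ) → f a (k ξ) ≤ β := by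
      intro ξ
      by_cases hξ : ξ ∈ Z
      · obtain ⟨β, hβ, hβ'⟩ := hq (V ξ fun ζ => k ζ.1) (k ξ) (hk ξ).ge fun n =>
          if h : ∃ a ∈ X, nd₀ _ a = n then f h.choose (k ξ) else 0
        refine ⟨β, fun _ => ⟨hβ, fun a ha hlt => ?_⟩⟩
        have h : ∃ a' ∈ X, nd₀ (V ξ fun ζ => k ζ.1) a' = nd₀ (V ξ fun ζ => k ζ.1) a := ⟨a, ha, rfl⟩
        have heq : f h.choose (k ξ) = f a (k ξ) := by
          by_contra hne
          exact hξ ⟨_, h.choose_spec.1, a, ha, fun ζ hζ =>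
            (hnd₀ _ _ _).1 h.choose_spec.2 _ (hkv ζ ξ hζ).le, hne⟩
        have := hβ' (nd₀ (V ξ fun ζ => k ζ.1) a)
        rw [dif_pos h, heq] at this
        exact (this hlt).le
      · exact ⟨0, fun h => absurd h hξ⟩
    choose β hβ using hβ
    let h : W → Ordinal.{u} := fun w => if hw : ∃ ξ ∈ Z, k ξ = w then β hw.choose else g w
    have hh : ∀ ξ ∈ Z, h (k ξ) = β ξ := fun ξ hξ => by
      have hw : ∃ ξ' ∈ Z, k ξ' = k ξ := ⟨ξ, hξ, rfl⟩
      have : hw.choose = ξ := hkm.injective hw.choose_spec.2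
      simp only [h]
      rw [dif_pos hw, this]
    have hh' : ∀ w, h w < g w → ∃ ξ ∈ Z, k ξ = w := fun w hw => by
      by_contra hcon
      simp only [h] at hw
      rw [dif_neg hcon] at hw
      exact hw.false
    obtain ⟨a, ha⟩ := hex h <| by
      rw [frequently_cocardinal, Order.succ_le_iff]
      refine (not_le.1 hZ).trans_le
        (mk_le_of_injective (f := fun ξ => ⟨k ξ, ?_⟩) fun ζ ξ h => Subtype.ext (hkm.injective ?_))
      · exact (hh ξ ξ.2).trans_lt (hβ ξ ξ.2).1
      · exact congrArg Subtype.val h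
    obtain ⟨b, hb, hab⟩ := exists_ge_of_lt_mk hLl hX a
    refine ha b hab.le ?_
    filter_upwards [hub b] with w hw hhw
    obtain ⟨ξ, hξ, rfl⟩ := hh' w hhw
    rw [hh ξ hξ]
    exact (hβ ξ hξ).2 b hb hw

end Filter

section ClosedSets

variable {L : Type u}

/-- The sets closed under a relation. -/
def ClosedSet (R : L → L → Prop) : Type u := {U : Set L // ∀ a b, R a b → a ∈ U → b ∈ U}

/-- Membership in `b` depends only on the values of `a`. -/
def IsSupportedOn {R : L → L → Prop} {ι : Type*} (a : ι → L) (b : Set (ClosedSet R)) : Prop :=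
  ∀ U V : ClosedSet R, (∀ i, a i ∈ U.1 ↔ a i ∈ V.1) → (U ∈ b ↔ V ∈ b)

/-- The Boolean algebra generated by the sets of the form `{U | a ∈ U}`, where `U` ranges over the
`R`-closed sets. -/
def supportedAlgebra (R : L → L → Prop) : BooleanSubalgebra (Set (ClosedSet R)) where
  carrier := {b | ∃ s : Finset L, IsSupportedOn (Subtype.val : s → L) b}
  supClosed' := by
    classical
    rintro b ⟨s, hs⟩ c ⟨t, ht⟩
    refine ⟨s ∪ t, fun U V h => ?_⟩
    exact or_congr (hs U V fun i => h ⟨i, Finset.mem_union_left _ i.2⟩)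
      (ht U V fun i => h ⟨i, Finset.mem_union_right _ i.2⟩)
  infClosed' := by
    classical
    rintro b ⟨s, hs⟩ c ⟨t, ht⟩
    refine ⟨s ∪ t, fun U V h => ?_⟩
    exact and_congr (hs U V fun i => h ⟨i, Finset.mem_union_left _ i.2⟩)
      (ht U V fun i => h ⟨i, Finset.mem_union_right _ i.2⟩)
  compl_mem' := by
    rintro b ⟨s, hs⟩
    exact ⟨s, fun U V h => not_congr (hs U V h)⟩
  bot_mem' := ⟨∅, fun _ _ _ => Iff.rfl⟩

variable {R : L → L → Prop}

theorem mem_supportedAlgebra {b : Set (ClosedSet R)} :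
    b ∈ supportedAlgebra R ↔ ∃ s : Finset L, IsSupportedOn (Subtype.val : s → L) b := Iff.rfl

/-- The generator `{U | a ∈ U}`. -/
def supportedAlgebra.gen (R : L → L → Prop) (a : L) : supportedAlgebra R :=
  ⟨{U | a ∈ U.1}, {a}, fun _ _ h => h ⟨a, Finset.mem_singleton_self a⟩⟩

theorem supportedAlgebra.gen_le {a b : L} (h : R a b) : gen R a ≤ gen R b :=
  fun U hU => U.2 a b h hU

theorem supportedAlgebra.rel_of_gen_le (hR : ∀ a, R a a)
    (hR' : ∀ a b c, R a b → R b c → R a c) {a b : L} (h : gen R a ≤ gen R b) : R a b :=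
  h (show (⟨{z | R a z}, fun b c hbc hb => hR' a b c hb hbc⟩ : ClosedSet R) ∈ _ from hR a)

theorem mk_supportedAlgebra_le [Infinite L] : #(supportedAlgebra R) ≤ #L := by
  classical
  have h := fun b : supportedAlgebra R => mem_supportedAlgebra.1 b.2
  choose s hs using h
  let t : supportedAlgebra R → Finset (Finset L) := fun b =>
    (s b).powerset.filter fun t => ∃ U ∈ b.1, ∀ a ∈ s b, a ∈ U.1 ↔ a ∈ t
  have hmem : ∀ b (U : ClosedSet R), U ∈ b.1 ↔ ((s b).filter fun a => a ∈ U.1) ∈ t b := by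
    intro b U
    simp only [t, Finset.mem_filter, Finset.mem_powerset, Finset.filter_subset, true_and]
    constructor
    · exact fun hU => ⟨U, hU, fun a ha => by simp [ha]⟩
    · rintro ⟨V, hV, h⟩
      refine (hs b V U fun a => ?_).1 hV
      simpa using h a a.2
  calc #(supportedAlgebra R) ≤ #(Finset L × Finset (Finset L)) := by
        refine mk_le_of_injective (f := fun b => (s b, t b)) fun b c hbc => ?_
        obtain ⟨h1, h2⟩ := Prod.mk.inj hbc
        ext U
        rw [hmem, hmem, h1, h2]
    _ = #L := by simp [mk_finset_of_infinite]

/-- A finite support of minimal size consists of critical elements. -/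
theorem exists_critical_support (b : supportedAlgebra R) :
    ∃ (n : ℕ) (a : Fin n → L), Function.Injective a ∧ IsSupportedOn a b.1 ∧
      ∀ i, ∃ U ∈ b.1, ∃ V ∉ b.1, ∀ j ≠ i, a j ∈ U.1 ↔ a j ∈ V.1 := by
  classical
  have hne : ∃ n, ∃ s : Finset L, s.card = n ∧ IsSupportedOn (Subtype.val : s → L) b.1 := by
    obtain ⟨s, hs⟩ := mem_supportedAlgebra.1 b.2
    exact ⟨_, s, rfl, hs⟩
  obtain ⟨s, hcard, hs⟩ := Nat.find_spec hne
  have e := s.equivFin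
  refine ⟨s.card, fun i => (e.symm i).1, Subtype.val_injective.comp e.symm.injective,
    fun U V h => hs U V fun i => ?_, fun i => ?_⟩
  · simpa using h (e i)
  · have h : ¬ IsSupportedOn (Subtype.val : (s.erase (e.symm i).1 : Finset L) → L) b.1 := by
      intro h
      refine Nat.find_min hne (m := (s.erase (e.symm i).1).card) ?_ ⟨_, rfl, h⟩
      rw [← hcard]
      exact Finset.card_erase_lt_of_mem (e.symm i).2
    simp only [IsSupportedOn, not_forall] at h
    obtain ⟨U, V, h, hUV⟩ := h
    have h' : ∀ j ≠ i, (e.symm j).1 ∈ U.1 ↔ (e.symm j).1 ∈ V.1 := fun j hj =>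
      h ⟨_, Finset.mem_erase.2 ⟨fun heq => hj (e.symm.injective (Subtype.ext heq)),
        (e.symm j).2⟩⟩
    by_cases hU : U ∈ b.1
    · exact ⟨U, hU, V, fun hV => hUV (by simp [hU, hV]), h'⟩
    · refine ⟨V, ?_, U, hU, fun j hj => (h' j hj).symm⟩
      by_contra hV
      exact hUV (by simp [hU, hV])

/-- Two elements of `supportedAlgebra R` of the same shape are not comparable if their supports are
interchangeable except for one pair of `R`-incomparable elements. -/
theorem not_le_of_not_rel {ι : Type*} (hR : ∀ a, R a a)
    (hR' : ∀ a b c, R a b → R b c → R a c) {a a' : ι → L} {b b' : Set (ClosedSet R)}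
    (hb : IsSupportedOn a b)
    (hbb' : ∀ U V : ClosedSet R, (∀ i, a i ∈ U.1 ↔ a' i ∈ V.1) → (U ∈ b ↔ V ∈ b'))
    (h1 : ∀ i j, i ≠ j → (R (a i) (a' j) ↔ R (a i) (a j)))
    (h2 : ∀ i j, i ≠ j → (R (a' i) (a j) ↔ R (a i) (a j)))
    (h3 : ∀ i j, i ≠ j → (R (a' i) (a' j) ↔ R (a i) (a j))) {k : ι}
    (hk : ¬ R (a k) (a' k)) (hk' : ¬ R (a' k) (a k))
    (hcrit : ∃ U ∈ b, ∃ V ∉ b, ∀ j ≠ k, a j ∈ U.1 ↔ a j ∈ V.1) : ¬ b ≤ b' := by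
  obtain ⟨U, hU, V, hV, hUV⟩ := hcrit
  let Z : ClosedSet R := ⟨{z | (∃ i, a i ∈ U.1 ∧ R (a i) z) ∨ ∃ i, a i ∈ V.1 ∧ R (a' i) z}, by
    rintro y z hyz (⟨i, hi, h⟩ | ⟨i, hi, h⟩)
    · exact Or.inl ⟨i, hi, hR' _ _ _ h hyz⟩
    · exact Or.inr ⟨i, hi, hR' _ _ _ h hyz⟩⟩
  have hZ : ∀ p, a p ∈ U.1 ↔ a p ∈ Z.1 := by
    refine fun p => ⟨fun h => Or.inl ⟨p, h, hR _⟩, ?_⟩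
    rintro (⟨i, hi, h⟩ | ⟨i, hi, h⟩)
    · exact U.2 _ _ h hi
    · by_cases hip : i = p
      · subst hip
        refine (hUV i ?_).2 hi
        rintro rfl
        exact hk' h
      · rw [h2 i p hip] at h
        by_cases hp : p = k
        · exact U.2 _ _ h ((hUV i (hp ▸ hip)).2 hi)
        · exact (hUV p hp).2 (V.2 _ _ h hi)
  have hZ' : ∀ p, a p ∈ V.1 ↔ a' p ∈ Z.1 := by
    refine fun p => ⟨fun h => Or.inr ⟨p, h, hR _⟩, ?_⟩
    rintro (⟨i, hi, h⟩ | ⟨i, hi, h⟩)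
    · by_cases hip : i = p
      · subst hip
        refine (hUV i ?_).1 hi
        rintro rfl
        exact hk h
      · rw [h1 i p hip] at h
        by_cases hp : p = k
        · exact V.2 _ _ h ((hUV i (hp ▸ hip)).1 hi)
        · exact (hUV p hp).1 (U.2 _ _ h hi)
    · by_cases hip : i = p
      · exact hip ▸ hi
      · exact V.2 _ _ ((h3 i p hip).1 h) hi
  exact fun hle => hV ((hbb' V Z hZ').2 (hle ((hb U Z hZ).1 hU)))

end ClosedSets

section LexRel

variable {W L : Type u} [LinearOrder W] {x : L → W → Ordinal.{u}} {A : Set W}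

/-- `a` and `b` are equal, or they first differ at a place in `A`, where `x a < x b`. -/
def LexRel (x : L → W → Ordinal.{u}) (A : Set W) (a b : L) : Prop :=
  a = b ∨ ∃ ξ ∈ A, (∀ ζ < ξ, x a ζ = x b ζ) ∧ x a ξ < x b ξ

theorem LexRel.refl (a : L) : LexRel x A a a := Or.inl rfl

theorem exists_first_difference [WellFoundedLT W] (hx : Function.Injective x) {a b : L}
    (hab : a ≠ b) : ∃ ξ, (∀ ζ < ξ, x a ζ = x b ζ) ∧ x a ξ ≠ x b ξ := by
  obtain ⟨ξ, hξ, hmin⟩ := WellFounded.has_min (wellFounded_lt (α := W)) {ξ | x a ξ ≠ x b ξ} <| by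
    by_contra h
    refine hab (hx (funext fun ξ => ?_))
    by_contra hne
    exact h ⟨ξ, hne⟩
  exact ⟨ξ, fun ζ hζ => not_not.1 fun h => hmin ζ h hζ, hξ⟩

theorem lexRel_iff {a b : L} {ξ : W} (h : ∀ ζ < ξ, x a ζ = x b ζ) (hne : x a ξ ≠ x b ξ) :
    LexRel x A a b ↔ ξ ∈ A ∧ x a ξ < x b ξ := by
  refine ⟨?_, fun h' => Or.inr ⟨ξ, h'.1, h, h'.2⟩⟩
  rintro (rfl | ⟨ζ, hζ, h1, h2⟩)
  · exact absurd rfl hne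
  · obtain rfl : ζ = ξ := by
      rcases lt_trichotomy ζ ξ with hlt | heq | hlt
      · exact absurd (h ζ hlt) h2.ne
      · exact heq
      · exact absurd (h1 ξ hlt) hne
    exact ⟨hζ, h2⟩

theorem LexRel.trans (a b c : L) : LexRel x A a b → LexRel x A b c → LexRel x A a c := by
  rintro (rfl | ⟨ξ, hξ, h1, h2⟩) hbc
  · exact hbc
  rcases hbc with rfl | ⟨ζ, hζ, h3, h4⟩
  · exact Or.inr ⟨ξ, hξ, h1, h2⟩
  rcases lt_trichotomy ξ ζ with hlt | rfl | hlt
  · exact Or.inr ⟨ξ, hξ, fun η hη => (h1 η hη).trans (h3 η (hη.trans hlt)), h3 ξ hlt ▸ h2⟩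
  · exact Or.inr ⟨ξ, hξ, fun η hη => (h1 η hη).trans (h3 η hη), h2.trans h4⟩
  · exact Or.inr ⟨ζ, hζ, fun η hη => (h1 η (hη.trans hlt)).trans (h3 η hη), h1 ζ hlt ▸ h4⟩

theorem LexRel.antisymm {a b : L} (hab : LexRel x A a b) (hba : LexRel x A b a) : a = b := by
  rcases hab with rfl | ⟨ξ, hξ, h1, h2⟩
  · rfl
  · have := (lexRel_iff (A := A) (fun ζ hζ => (h1 ζ hζ).symm) h2.ne').1 hba
    exact absurd this.2 h2.not_gt

theorem lexRel_congr [WellFoundedLT W] {a a' b b' : L} {ξ : W} (ha : ∀ ζ ≤ ξ, x a ζ = x a' ζ)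
    (hb : ∀ ζ ≤ ξ, x b ζ = x b' ζ) (hab : ¬ ∀ ζ ≤ ξ, x a ζ = x b ζ) :
    LexRel x A a b ↔ LexRel x A a' b' := by
  push Not at hab
  obtain ⟨η, ⟨hηξ, hη⟩, hmin⟩ := WellFounded.has_min (wellFounded_lt (α := W))
    {ζ | ζ ≤ ξ ∧ x a ζ ≠ x b ζ} hab
  have h : ∀ ζ < η, x a ζ = x b ζ := fun ζ hζ =>
    not_not.1 fun h => hmin ζ ⟨hζ.le.trans hηξ, h⟩ hζ
  rw [lexRel_iff h hη, lexRel_iff (ξ := η), ha η hηξ, hb η hηξ]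
  · intro ζ hζ
    rw [← ha ζ (hζ.le.trans hηξ), ← hb ζ (hζ.le.trans hηξ), h ζ hζ]
  · rwa [← ha η hηξ, ← hb η hηξ]

/-- If `x` splits often, and `A` omits many levels, then the algebra of `LexRel x A` has only small
chains. -/
theorem mk_chain_le_of_splitting [WellFoundedLT W] [Nonempty W] {κ l : Cardinal.{u}}
    (hl : ℵ₀ ≤ l) (hW : #W ≤ l) {N : W → Type u} {nd : ∀ ξ, L → N ξ} (hN : ∀ ξ, #(N ξ) ≤ l)
    (hnd : ∀ ξ a b, nd ξ a = nd ξ b ↔ ∀ ζ ≤ ξ, x a ζ = x b ζ) (hx : Function.Injective x)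
    (hsplit : ∀ X : Set L, l < #X →
      #{ξ | ¬ ∃ a ∈ X, ∃ b ∈ X, (∀ ζ < ξ, x a ζ = x b ζ) ∧ x a ξ ≠ x b ξ} ≤ κ)
    (hA : κ < #(Aᶜ : Set W)) {C : Set (supportedAlgebra (LexRel x A))}
    (hC : IsChain (· ≤ ·) C) : #C ≤ l := by
  classical
  by_contra! hCl
  let Code : Type u := Σ n : ULift.{u} ℕ, Σ ξ : W, (Fin n.down → N ξ) × Set (Set (Fin n.down))
  have hCode : #Code ≤ l := by
    refine mk_sigma_le_of_le hl (by simpa using hl) fun n => mk_sigma_le_of_le hl hW fun ξ => ?_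
    rw [mk_prod]
    refine mul_le_of_le hl ?_ ?_
    · have : #(Fin n.down → N ξ) = #(N ξ) ^ n.down := by simp
      rw [lift_uzero, this]
      exact (pow_le_pow_left' (hN ξ) _).trans (power_nat_le hl)
    · exact (lift_le_aleph0.2 mk_le_aleph0).trans hl
  have hcode : ∀ b : supportedAlgebra (LexRel x A), ∃ c : Code, ∃ a : Fin c.1.down → L,
      (IsSupportedOn a b.1 ∧ ∀ i, ∃ U ∈ b.1, ∃ V ∉ b.1, ∀ j ≠ i, a j ∈ U.1 ↔ a j ∈ V.1) ∧
      (∀ i j, i ≠ j → c.2.2.1 i ≠ c.2.2.1 j) ∧ (∀ i, nd c.2.1 (a i) = c.2.2.1 i) ∧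
      ∀ S, S ∈ c.2.2.2 ↔ ∃ U ∈ b.1, a ⁻¹' U.1 = S := by
    intro b
    obtain ⟨n, a, ha, hsupp, hcrit⟩ := exists_critical_support b
    have hdiff : ∀ p : Fin n × Fin n, ∃ ξ, p.1 ≠ p.2 → x (a p.1) ξ ≠ x (a p.2) ξ := fun p => by
      by_cases hp : p.1 = p.2
      · exact ⟨Classical.arbitrary W, fun h => absurd hp h⟩
      · obtain ⟨ξ, -, hξ⟩ := exists_first_difference hx (ha.ne hp)
        exact ⟨ξ, fun _ => hξ⟩
    choose d hd using hdiff
    obtain ⟨ξ, hξ⟩ := Finite.exists_le d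
    refine ⟨⟨⟨n⟩, ξ, fun i => nd ξ (a i), {S | ∃ U ∈ b.1, a ⁻¹' U.1 = S}⟩, a, ⟨hsupp, hcrit⟩,
      fun i j hij h => hd (i, j) hij ((hnd _ _ _).1 h _ (hξ (i, j))), fun _ => rfl,
      fun _ => Iff.rfl⟩
  choose φ hφ using hcode
  obtain ⟨⟨⟨n⟩, ξ, ν, T⟩, hc⟩ := exists_lt_mk_fiber_of_lt_mk_set hl φ hCode hCl
  set C' := {b ∈ C | φ b = ⟨⟨n⟩, ξ, ν, T⟩}
  have hgood : ∀ b : C', ∃ a : Fin n → L,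
      (IsSupportedOn a b.1.1 ∧ ∀ i, ∃ U ∈ b.1.1, ∃ V ∉ b.1.1, ∀ j ≠ i, a j ∈ U.1 ↔ a j ∈ V.1) ∧
      (∀ i j, i ≠ j → ν i ≠ ν j) ∧ (∀ i, nd ξ (a i) = ν i) ∧
      ∀ S, S ∈ T ↔ ∃ U ∈ b.1.1, a ⁻¹' U.1 = S := by
    rintro ⟨b, -, hb⟩
    have := hφ b
    rw [hb] at this
    exact this
  choose a ha hν hnda hT using hgood
  have htransfer : ∀ (b b' : C') (U V : ClosedSet (LexRel x A)),
      (∀ i, a b i ∈ U.1 ↔ a b' i ∈ V.1) → U ∈ b.1.1 → V ∈ b'.1.1 := by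
    intro b b' U V hUV hU
    have h : a b ⁻¹' U.1 = a b' ⁻¹' V.1 := Set.ext hUV
    obtain ⟨V', hV', h'⟩ := (hT b' _).1 ((hT b _).2 ⟨U, hU, rfl⟩)
    exact ((ha b').1 V' V fun i => Set.ext_iff.1 (h'.trans h) i).1 hV'
  have hinj : Function.Injective a := by
    intro b b' hbb'
    refine Subtype.ext (Subtype.ext (Set.ext fun U => ⟨?_, ?_⟩))
    · exact htransfer b b' U U fun i => by rw [hbb']
    · exact htransfer b' b U U fun i => by rw [hbb']
  obtain ⟨k, hk⟩ : ∃ k, l < #(Set.range fun b => a b k) := by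
    by_contra! h
    refine hc.not_ge ?_
    have hS : #(⋃ k : Fin n, Set.range fun b => a b k) ≤ l := by
      have := mk_iUnion_le_lift.{u, 0} fun k : Fin n => Set.range fun b => a b k
      simp only [lift_uzero] at this
      refine this.trans (mul_le_of_le hl ((lift_le_aleph0.2 mk_le_aleph0).trans hl) ?_)
      exact ciSup_le' h
    refine (mk_le_of_injective (f := fun b => List.ofFn fun k =>
      (⟨a b k, Set.mem_iUnion.2 ⟨k, b, rfl⟩⟩ : ⋃ k : Fin n, Set.range fun b => a b k)) ?_).trans
      ((mk_list_le_max _).trans (max_le hl hS))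
    intro b b' h
    refine hinj (funext fun k => ?_)
    exact congrArg Subtype.val (congrFun (List.ofFn_injective h) k)
  obtain ⟨η, hηA, hη⟩ : ∃ η ∉ A, ∃ b b', (∀ ζ < η, x (a b k) ζ = x (a b' k) ζ) ∧
      x (a b k) η ≠ x (a b' k) η := by
    by_contra! h
    refine (hA.trans_le (mk_le_mk_of_subset fun η hη => ?_)).not_ge (hsplit _ hk)
    rintro ⟨_, ⟨b, rfl⟩, _, ⟨b', rfl⟩, h1, h2⟩
    exact h2 (h η hη b b' h1)
  obtain ⟨b, b', hlow, hne⟩ := hη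
  have hrel : ∀ b₁ b₂ b₃ b₄ : C', ∀ i j, i ≠ j →
      (LexRel x A (a b₁ i) (a b₂ j) ↔ LexRel x A (a b₃ i) (a b₄ j)) := by
    intro b₁ b₂ b₃ b₄ i j hij
    refine lexRel_congr (ξ := ξ) ?_ ?_ ?_
    · rw [← hnd, hnda, hnda]
    · rw [← hnd, hnda, hnda]
    · rw [← hnd, hnda, hnda]
      exact hν b i j hij
  have hnot : ∀ b b' : C', (∀ ζ < η, x (a b k) ζ = x (a b' k) ζ) →
      x (a b k) η ≠ x (a b' k) η → ¬ b.1.1 ≤ b'.1.1 := by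
    intro b b' hlow hne
    refine not_le_of_not_rel LexRel.refl LexRel.trans (ha b).1
      (fun U V h => ⟨htransfer b b' U V h, htransfer b' b V U fun i => (h i).symm⟩)
      (hrel _ _ _ _) (hrel _ _ _ _) (hrel _ _ _ _) ?_ ?_ ((ha b).2 k)
    · rw [lexRel_iff hlow hne]
      exact fun h => hηA h.1
    · rw [lexRel_iff (fun ζ hζ => (hlow ζ hζ).symm) hne.symm]
      exact fun h => hηA h.1
  rcases hC.total b.2.1 b'.2.1 with h | h
  · exact hnot b b' hlow hne h
  · exact hnot b' b (fun ζ hζ => (hlow ζ hζ).symm) hne.symm h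

end LexRel

/-- A set of cardinality `κ⁺` is the union of `κ` disjoint sets of cardinality `κ⁺`. -/
theorem exists_map_lt_mk_fiber {κ : Cardinal.{u}} (hκ : ℵ₀ ≤ κ) {W : Type u} (hI : #I = κ)
    (hW : #W = Order.succ κ) : ∃ h : W → I, ∀ i, κ < #{w | h w = i} := by
  have hcard : #W = #(W × I) := by
    rw [mk_prod, lift_id, lift_id, hW, hI, mul_eq_left (hκ.trans (Order.le_succ κ))
      (Order.le_succ κ) (aleph0_pos.trans_le hκ).ne']
  obtain ⟨e⟩ := Cardinal.eq.1 hcard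
  refine ⟨fun w => (e w).2, fun i => (Order.lt_succ κ).trans_le ?_⟩
  rw [← hW]
  refine mk_le_of_injective (f := fun w => ⟨e.symm (w, i), by simp⟩) fun v w h => ?_
  simpa using h

theorem lengthBA_le {A : Type u} [BooleanAlgebra A] {l : Cardinal.{u}}
    (h : ∀ C : Set A, IsChain (· ≤ ·) C → #C ≤ l) : lengthBA A ≤ l :=
  csSup_le' <| by
    rintro _ ⟨C, hC, rfl⟩
    exact h C hC

theorem mk_le_lengthBA {A : Type u} [BooleanAlgebra A] {C : Set A} (hC : IsChain (· ≤ ·) C) :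
    #C ≤ lengthBA A := by
  refine le_csSup ⟨#A, ?_⟩ ⟨C, hC, rfl⟩
  rintro _ ⟨C', -, rfl⟩
  exact mk_set_le C'

theorem stmt_16 (κ : Cardinal.{u}) (hκ : ℵ₀ ≤ κ) (I : Type u) (hI : #I = κ)
    (D : Ultrafilter I) (hD : ∀ s ∈ D, #s = κ) (θ : Cardinal.{u}) :
    ∃ l : Cardinal.{u}, θ ≤ l ∧ l ^ κ = l ∧
      ∃ (B : I → Type u) (_ : ∀ i, BooleanAlgebra (B i)),
        (∀ i, lengthBA (B i) ≤ l) ∧ lengthBA (UProd D B) = Order.succ l := by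
  obtain ⟨l, hθ, hl, hκl, W, L, _, _, _, N, nd, x, hW, hL, hLl, hN, hnd, hx, hsplit⟩ :=
    Filter.exists_splitting_family hκ θ
  have hl0 : ℵ₀ ≤ l := (hκ.trans (Order.le_succ κ)).trans hκl.le
  have : Nonempty W := by
    rw [← mk_ne_zero_iff, hW]
    exact Order.succ_ne_bot κ
  have : Infinite L := by
    rw [infinite_iff, hL]
    exact hl0.trans (Order.le_succ l)
  obtain ⟨h, hh⟩ := exists_map_lt_mk_fiber hκ hI hW
  let A : I → Set W := fun i => {w | h w ≠ i}
  have hA : ∀ ξ, ∀ᶠ i in (D : Filter I), ξ ∈ A i := fun ξ => by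
    have h1 : ({h ξ} : Set I) ∉ D := fun hmem => by
      have := hD _ hmem
      rw [mk_singleton] at this
      exact (one_lt_aleph0.trans_le hκ).ne this
    filter_upwards [Ultrafilter.compl_mem_iff_notMem.2 h1] with i hi
    exact fun heq => hi heq.symm
  let R : I → L → L → Prop := fun i => LexRel x (A i)
  refine ⟨l, hθ, hl, fun i => supportedAlgebra (R i), fun i => inferInstance, fun i => ?_,
    le_antisymm ?_ ?_⟩
  · refine lengthBA_le fun C hC => ?_
    refine mk_chain_le_of_splitting hl0 (hW ▸ hκl.le) hN hnd hx hsplit ((hh i).trans_le ?_) hC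
    exact mk_le_mk_of_subset fun w hw => not_not.2 hw
  · refine lengthBA_le fun C _ => (mk_set_le C).trans ?_
    calc #(UProd D fun i => supportedAlgebra (R i))
        ≤ #(∀ i, supportedAlgebra (R i)) := mk_quotient_le
      _ = Cardinal.prod fun i => #(supportedAlgebra (R i)) := mk_pi _
      _ ≤ Cardinal.prod fun _ : I => #L := prod_le_prod _ _ fun i => mk_supportedAlgebra_le
      _ = #(I → L) := by simp
      _ ≤ Order.succ l := by
        refine mk_arrow_le_of_bounded hl0 hLl (hL ▸ Order.lt_succ l)
          (hI.trans_le ((Order.le_succ κ).trans hκl.le)) id (hl0.trans (Order.le_succ l)) hL.le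
          fun w => le_trans ?_ (Order.le_succ l)
        rw [← power_def, hI]
        exact (power_le_power_right (hLl w)).trans hl.le
  · let G : L → UProd D fun i => supportedAlgebra (R i) := fun a =>
      Quotient.mk _ fun i => supportedAlgebra.gen (R i) a
    have hG : Function.Injective G := fun a b hab => by
      have h' : ∀ᶠ i in (D : Filter I), supportedAlgebra.gen (R i) a =
        supportedAlgebra.gen (R i) b := Quotient.exact hab
      obtain ⟨i, hi⟩ := h'.exists
      exact LexRel.antisymm
        (supportedAlgebra.rel_of_gen_le LexRel.refl LexRel.trans hi.le)
        (supportedAlgebra.rel_of_gen_le LexRel.refl LexRel.trans hi.ge)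
    have hlt : ∀ a b ξ, (∀ ζ < ξ, x a ζ = x b ζ) → x a ξ < x b ξ → G a ≤ G b :=
      fun a b ξ h1 h2 => by
        show ∀ᶠ i in (D : Filter I), supportedAlgebra.gen (R i) a ≤ supportedAlgebra.gen (R i) b
        filter_upwards [hA ξ] with i hi
        exact supportedAlgebra.gen_le (Or.inr ⟨ξ, hi, h1, h2⟩)
    rw [← hL, ← mk_range_eq G hG]
    refine mk_le_lengthBA ?_
    rintro _ ⟨a, rfl⟩ _ ⟨b, rfl⟩ hab
    obtain ⟨ξ, h1, h2⟩ := exists_first_difference hx (ne_of_apply_ne G hab)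
    rcases h2.lt_or_gt with h2 | h2
    · exact Or.inl (hlt a b ξ h1 h2)
    · exact Or.inr (hlt b a ξ (fun ζ hζ => (h1 ζ hζ).symm) h2)
end

section
/- Let κ be an infinite cardinal and let D be a uniform ultrafilter on κ. Then for every cardinal θ there is a cardinal χ ≥ θ with χ^κ = χ for which there exists a system ⟨B_i : i < κ⟩ of Boolean algebras such that s(B_i) ≤ χ for each i < κ, while s(∏_{i<κ} B_i / D) = χ⁺. -/
universe u

open Cardinal Filter

variable {I : Type u}

/-- `X` is ideal-independent: no member of `X` is below the join of finitely many
other members of `X`. -/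
def IdealIndep {A : Type u} [BooleanAlgebra A] (X : Set A) : Prop :=
  ∀ x ∈ X, ∀ F : Finset A, ↑F ⊆ X \ {x} → ¬ x ≤ F.sup id

/-- The spread of a Boolean algebra: the supremum of the cardinalities of
ideal-independent subsets. -/
noncomputable def spreadBA (A : Type u) [BooleanAlgebra A] : Cardinal.{u} :=
  sSup {μ : Cardinal.{u} | ∃ X : Set A, IdealIndep X ∧ #X = μ}

namespace SpreadUltra

section Regular

variable {Z : Type u} [LinearOrder Z] {μ : Cardinal.{u}}

theorem exists_strict_bound (hμ : ℵ₀ ≤ μ) (hZ : μ < #Z) (hI : ∀ z : Z, #(Set.Iic z) ≤ μ)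
    {s : Set Z} (hs : #s ≤ μ) : ∃ b, ∀ x ∈ s, x < b := by
  by_contra! h
  have h1 : (Set.univ : Set Z) ⊆ ⋃ x : s, Set.Iic (x : Z) := fun b _ => by
    obtain ⟨x, hx, hb⟩ := h b
    exact Set.mem_iUnion.2 ⟨⟨x, hx⟩, hb⟩
  have h2 : #Z ≤ μ := by
    rw [← mk_univ]
    calc #(Set.univ : Set Z) ≤ #(⋃ x : s, Set.Iic (x : Z)) := mk_le_mk_of_subset h1
      _ ≤ Cardinal.sum fun x : s => #(Set.Iic (x : Z)) := mk_iUnion_le_sum_mk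
      _ ≤ Cardinal.sum fun _ : s => μ := sum_le_sum _ _ fun x => hI x
      _ = #s * μ := sum_const' _ _
      _ ≤ μ * μ := by gcongr
      _ = μ := mul_eq_self hμ
  exact absurd hZ h2.not_gt

theorem exists_gt_of_lt_mk (hI : ∀ z : Z, #(Set.Iic z) ≤ μ) {s : Set Z} (hs : μ < #s) (z : Z) :
    ∃ x ∈ s, z < x := by
  by_contra! h
  exact absurd hs ((mk_le_mk_of_subset (fun x hx => h x hx : s ⊆ Set.Iic z)).trans (hI z)).not_gt

theorem exists_unbounded_fiber {Y : Type u} (hμ : ℵ₀ ≤ μ) (hZ : μ < #Z)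
    (hI : ∀ z : Z, #(Set.Iic z) ≤ μ) (hY : #Y ≤ μ) (φ : Z → Y) :
    ∃ y, ∀ z, ∃ z', φ z' = y ∧ z < z' := by
  by_contra! h
  choose g hg using h
  obtain ⟨b, hb⟩ := exists_strict_bound hμ hZ hI (s := Set.range g) (mk_range_le.trans hY)
  exact (hg (φ b) b rfl).not_gt (hb _ ⟨_, rfl⟩)

theorem mk_pi_le_of_bounded {I : Type u} (hμ : ℵ₀ ≤ μ) (hZ : #Z ≤ μ)
    (hI : ∀ z : Z, #(Set.Iio z) ^ #I ≤ μ) (hb : ∀ f : I → Z, ∃ z, ∀ i, f i < z) :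
    #(I → Z) ≤ μ := by
  choose g hg using hb
  let e : (I → Z) → Σ z : Z, (I → Set.Iio z) := fun f => ⟨g f, fun i => ⟨f i, hg f i⟩⟩
  have he : Function.LeftInverse (fun p : Σ z : Z, (I → Set.Iio z) => fun i => (p.2 i : Z)) e :=
    fun f => rfl
  calc #(I → Z) ≤ #(Σ z : Z, (I → Set.Iio z)) := mk_le_of_injective he.injective
    _ = Cardinal.sum fun z : Z => #(Set.Iio z) ^ #I := by simp [mk_sigma]
    _ ≤ Cardinal.sum fun _ : Z => μ := sum_le_sum _ _ hI
    _ = #Z * μ := sum_const' _ _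
    _ ≤ μ * μ := by gcongr
    _ = μ := mul_eq_self hμ

end Regular

theorem mk_Iic_ord_toType_lt {a : Cardinal.{u}} (ha : ℵ₀ ≤ a) (i : a.ord.ToType) :
    #(Set.Iic i) < a := by
  simpa using mk_Iic_lt i (by simp) (by simpa using ha)

theorem mk_Iic_succ_ord_toType_le {a : Cardinal.{u}} (ha : ℵ₀ ≤ a)
    (i : (Order.succ a).ord.ToType) : #(Set.Iic i) ≤ a :=
  Order.lt_succ_iff.1 (mk_Iic_ord_toType_lt (ha.trans (Order.le_succ a)) i)

theorem exists_mk_Iio_eq {a b : Cardinal.{u}} (h : a < b) :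
    ∃ w : b.ord.ToType, #(Set.Iio w) = a := by
  obtain ⟨w, hw⟩ := Ordinal.typein_surj (α := b.ord.ToType) (· < ·) (o := a.ord)
    (by simpa using ord_lt_ord.2 h)
  refine ⟨w, ?_⟩
  have := Ordinal.card_typein (r := fun x y : b.ord.ToType => x < y) w
  rw [hw, card_ord] at this
  exact this.symm

/-- A cofinal sequence of cardinals `c` of regular length `κ⁺` in a strong limit cardinal `χ`,
along with a model `W` of `χ` in which each `c ξ` is marked by a point. -/
structure Scale (κ χ : Cardinal.{u}) (L W : Type u) [LinearOrder L] [LinearOrder W] where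
  c : L → Cardinal.{u}
  mark : L → W
  aleph0_le : ℵ₀ ≤ κ
  mk_level : #L = Order.succ κ
  mk_Iic_level : ∀ ξ : L, #(Set.Iic ξ) ≤ κ
  two_power_le : ∀ ξ ξ', ξ < ξ' → 2 ^ c ξ ≤ c ξ'
  succ_le : ∀ ξ, Order.succ κ ≤ c ξ
  c_lt : ∀ ξ, c ξ < χ
  exists_lt_c : ∀ a < χ, ∃ ξ, a < c ξ
  mk_W : #W = χ
  mk_Iic_W : ∀ w : W, #(Set.Iic w) < χ
  mk_Iio_mark : ∀ ξ, #(Set.Iio (mark ξ)) = c ξ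

theorem exists_scale {κ : Cardinal.{u}} (hκ : ℵ₀ ≤ κ) (θ : Cardinal.{u}) :
    ∃ χ, θ ≤ χ ∧ Nonempty (Scale κ χ (Order.succ κ).ord.ToType χ.ord.ToType) := by
  set L := (Order.succ κ).ord.ToType
  have hL : #L = Order.succ κ := mk_ord_toType _
  have hIic : ∀ ξ : L, #(Set.Iic ξ) ≤ κ := mk_Iic_succ_ord_toType_le hκ
  let o : Ordinal.{u} := (max θ (Order.succ κ)).ord
  let t : L → Ordinal.{u} := Ordinal.typein (α := L) (· < ·)
  let c : L → Cardinal.{u} := fun ξ => ℶ_ (o + t ξ)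
  have hc0 : ∀ ξ, max θ (Order.succ κ) ≤ c ξ := fun ξ =>
    (le_beth_ord _).trans (beth_strictMono.monotone le_self_add)
  have hc : ∀ ξ ξ', ξ < ξ' → 2 ^ c ξ ≤ c ξ' := fun ξ ξ' h => by
    rw [← beth_succ]
    refine beth_strictMono.monotone (Order.succ_le_of_lt ?_)
    have : t ξ < t ξ' := (Ordinal.typein_lt_typein (α := L) (· < ·)).2 h
    gcongr
  have hlt : ∀ ξ ξ', ξ < ξ' → c ξ < c ξ' := fun ξ ξ' h => (cantor _).trans_le (hc ξ ξ' h)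
  have hnext : ∀ ξ : L, ∃ ξ', ξ < ξ' := fun ξ => by
    obtain ⟨b, hb⟩ := exists_strict_bound hκ (hL ▸ Order.lt_succ κ) hIic (s := {ξ})
      (by simpa using one_le_aleph0.trans hκ)
    exact ⟨b, hb ξ rfl⟩
  let χ : Cardinal.{u} := ⨆ ξ, c ξ
  have hle : ∀ ξ, c ξ ≤ χ := fun ξ => le_ciSup (bddAbove_of_small) ξ
  have hcχ : ∀ ξ, c ξ < χ := fun ξ => by
    obtain ⟨ξ', h⟩ := hnext ξ
    exact (hlt _ _ h).trans_le (hle ξ')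
  have hne : Nonempty L := mk_ne_zero_iff.1 (by
    rw [hL]; exact (Order.bot_lt_succ κ).ne')
  have hχ : ℵ₀ ≤ χ := (hκ.trans (Order.le_succ κ)).trans
    ((le_max_right _ _).trans ((hc0 hne.some).trans (hle _)))
  have hmark : ∀ ξ, ∃ w : χ.ord.ToType, #(Set.Iio w) = c ξ := fun ξ => exists_mk_Iio_eq (hcχ ξ)
  choose mark hmark using hmark
  exact ⟨χ, (le_max_left _ _).trans ((hc0 hne.some).trans (hle _)),
    ⟨⟨c, mark, hκ, hL, hIic, hc, fun ξ => (le_max_right _ _).trans (hc0 ξ), hcχ,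
      fun a ha => exists_lt_of_lt_ciSup' ha, mk_ord_toType _, mk_Iic_ord_toType_lt hχ, hmark⟩⟩⟩

namespace Scale

variable {κ χ : Cardinal.{u}} {L W : Type u} [LinearOrder L] [LinearOrder W]

theorem lt_mk_level (S : Scale κ χ L W) : κ < #L := S.mk_level ▸ Order.lt_succ κ

theorem exists_gt (S : Scale κ χ L W) (ξ : L) : ∃ ξ', ξ < ξ' := by
  obtain ⟨b, hb⟩ := exists_strict_bound S.aleph0_le S.lt_mk_level S.mk_Iic_level (s := {ξ})
    (by simpa using one_le_aleph0.trans S.aleph0_le)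
  exact ⟨b, hb ξ rfl⟩

theorem nonempty (S : Scale κ χ L W) : Nonempty L :=
  mk_ne_zero_iff.1 (by rw [S.mk_level]; exact (Order.bot_lt_succ κ).ne')

theorem c_strictMono (S : Scale κ χ L W) : StrictMono S.c :=
  fun _ _ h => (cantor _).trans_le (S.two_power_le _ _ h)

theorem le_c (S : Scale κ χ L W) (ξ : L) : κ ≤ S.c ξ := (Order.le_succ κ).trans (S.succ_le ξ)

theorem aleph0_le_c (S : Scale κ χ L W) (ξ : L) : ℵ₀ ≤ S.c ξ := S.aleph0_le.trans (S.le_c ξ)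

theorem aleph0_le_χ (S : Scale κ χ L W) : ℵ₀ ≤ χ :=
  (S.aleph0_le_c S.nonempty.some).trans (S.c_lt _).le

theorem succ_lt_χ (S : Scale κ χ L W) : Order.succ κ < χ :=
  (S.succ_le S.nonempty.some).trans_lt (S.c_lt _)

theorem lt_χ (S : Scale κ χ L W) : κ < χ := (Order.lt_succ κ).trans S.succ_lt_χ

theorem two_power_lt (S : Scale κ χ L W) {a : Cardinal.{u}} (ha : a < χ) : 2 ^ a < χ := by
  obtain ⟨ξ, h⟩ := S.exists_lt_c a ha
  obtain ⟨ξ', h'⟩ := S.exists_gt ξ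
  exact ((power_le_power_left two_ne_zero h.le).trans (S.two_power_le _ _ h')).trans_lt (S.c_lt _)

theorem c_power_le (S : Scale κ χ L W) (ξ : L) : S.c ξ ^ Order.succ κ ≤ 2 ^ S.c ξ := by
  calc S.c ξ ^ Order.succ κ ≤ S.c ξ ^ S.c ξ :=
        power_le_power_left (aleph0_pos.trans_le (S.aleph0_le_c ξ)).ne' (S.succ_le ξ)
    _ = 2 ^ S.c ξ := power_self_eq (S.aleph0_le_c ξ)

theorem power_lt (S : Scale κ χ L W) {a b : Cardinal.{u}} (ha : a < χ) (hb : b < χ) :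
    a ^ b < χ := by
  have hm : max (max a b) ℵ₀ < χ := max_lt (max_lt ha hb)
    ((S.aleph0_le_c S.nonempty.some).trans_lt (S.c_lt _))
  refine lt_of_le_of_lt ?_ (S.two_power_lt hm)
  rw [← power_self_eq (le_max_right _ _)]
  refine (power_le_power_right ((le_max_left a b).trans (le_max_left _ ℵ₀))).trans ?_
  exact power_le_power_left (aleph0_pos.trans_le (le_max_right _ _)).ne'
    ((le_max_right a b).trans (le_max_left _ _))

theorem lt_mark (S : Scale κ χ L W) {w : W} {ξ : L} (h : #(Set.Iic w) < S.c ξ) :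
    w < S.mark ξ := by
  by_contra! h'
  refine h.not_ge ?_
  rw [← S.mk_Iio_mark ξ]
  exact mk_le_mk_of_subset fun x hx => (le_of_lt hx).trans h'

theorem χ_power (S : Scale κ χ L W) : χ ^ κ = χ := by
  refine le_antisymm ?_ (self_le_power _ (one_le_aleph0.trans S.aleph0_le))
  have hI : #(Quotient.out κ) = κ := mk_out κ
  have := mk_pi_le_of_bounded (I := Quotient.out κ) (Z := W) S.aleph0_le_χ S.mk_W.le
    (fun z => ?_) (fun f => ?_)
  · rwa [mk_arrow, S.mk_W, hI, lift_id, lift_id] at this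
  · rw [hI]
    exact (S.power_lt ((mk_le_mk_of_subset fun x hx => le_of_lt hx).trans_lt (S.mk_Iic_W z))
      S.lt_χ).le
  · choose g hg using fun i => S.exists_lt_c _ (S.mk_Iic_W (f i))
    obtain ⟨b, hb⟩ := exists_strict_bound S.aleph0_le S.lt_mk_level S.mk_Iic_level
      (s := Set.range g) (mk_range_le.trans hI.le)
    exact ⟨S.mark b, fun i => S.lt_mark ((hg i).trans (S.c_strictMono (hb _ ⟨i, rfl⟩)))⟩

theorem succ_χ_power (S : Scale κ χ L W) : (Order.succ χ) ^ κ = Order.succ χ := by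
  refine le_antisymm ?_ (self_le_power _ (one_le_aleph0.trans S.aleph0_le))
  have hI : #(Quotient.out κ) = κ := mk_out κ
  have hle := S.aleph0_le_χ.trans (Order.le_succ χ)
  have hIic := mk_Iic_succ_ord_toType_le S.aleph0_le_χ
  have := mk_pi_le_of_bounded (I := Quotient.out κ) (Z := (Order.succ χ).ord.ToType) hle
    (mk_ord_toType _).le (fun z => ?_) (fun f => ?_)
  · rwa [mk_arrow, mk_ord_toType, hI, lift_id, lift_id] at this
  · rw [hI]
    refine le_trans (power_le_power_right (b := χ) ?_) (S.χ_power.le.trans (Order.le_succ χ))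
    exact (mk_le_mk_of_subset Set.Iio_subset_Iic_self).trans (hIic z)
  · obtain ⟨b, hb⟩ := exists_strict_bound S.aleph0_le_χ
      (by rw [mk_ord_toType]; exact Order.lt_succ χ) hIic (s := Set.range f)
      (mk_range_le.trans (hI.le.trans S.lt_χ.le))
    exact ⟨b, fun i => hb _ ⟨i, rfl⟩⟩

end Scale

theorem exists_wf_rec {Λ T : Type*} [LT Λ] [WellFoundedLT Λ]
    {P : ∀ a : Λ, (∀ b, b < a → T) → T → Prop} (h : ∀ a g, ∃ t, P a g t) :
    ∃ f : Λ → T, ∀ a, P a (fun b _ => f b) (f a) := by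
  choose F hF using h
  refine ⟨wellFounded_lt.fix F, fun a => ?_⟩
  have := hF a (fun b _ => wellFounded_lt.fix F b)
  rwa [← wellFounded_lt.fix_eq F a] at this

section Ceil

variable {W : Type u} [LinearOrder W] [WellFoundedLT W]

/-- The least element of `s` above `x`, if there is any. -/
noncomputable def ceil (s : Set W) (x : W) : W :=
  open Classical in
  if h : {y | y ∈ s ∧ x ≤ y}.Nonempty then wellFounded_lt.min {y | y ∈ s ∧ x ≤ y} h else x

theorem ceil_spec {s : Set W} {x y : W} (hy : y ∈ s) (hxy : x ≤ y) :
    ceil s x ∈ s ∧ x ≤ ceil s x := by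
  have h : {y | y ∈ s ∧ x ≤ y}.Nonempty := ⟨y, hy, hxy⟩
  rw [ceil, dif_pos h]
  exact wellFounded_lt.min_mem _ h

theorem ceil_le {s : Set W} {x y : W} (hy : y ∈ s) (hxy : x ≤ y) : ceil s x ≤ y := by
  have h : {y | y ∈ s ∧ x ≤ y}.Nonempty := ⟨y, hy, hxy⟩
  rw [ceil, dif_pos h]
  exact not_lt.1 (wellFounded_lt.not_lt_min {y | y ∈ s ∧ x ≤ y} ⟨hy, hxy⟩)

end Ceil

section Lub

variable {χ σ : Cardinal.{u}} {L W Λ : Type u} [LinearOrder W] [WellFoundedLT W] [LinearOrder Λ]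

theorem exists_eventual_ceil (F : Filter L) (hσ : ℵ₀ ≤ σ) (hL : #L ≤ σ) (h2 : 2 ^ σ ≤ χ)
    (hΛ : χ < #Λ) (hI : ∀ α : Λ, #(Set.Iic α) ≤ χ) (f : Λ → L → W)
    (hf : ∀ α β, α < β → ∀ᶠ ξ in F, f α ξ ≤ f β ξ) (b : L → W) (hb : ∀ α ξ, f α ξ ≤ b ξ)
    (S : L → Set W) (hbS : ∀ ξ, b ξ ∈ S ξ) (hS : ∀ ξ, #(S ξ) ≤ σ) :
    ∃ h : L → W, (∀ α, ∀ᶠ ξ in F, f α ξ ≤ h ξ) ∧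
      ∃ a, ∀ α, a ≤ α → ∀ᶠ ξ in F, ceil (S ξ) (f α ξ) = h ξ := by
  have hχ : ℵ₀ ≤ χ := hσ.trans ((cantor σ).le.trans h2)
  have hY : #(∀ ξ, S ξ) ≤ χ := by
    rw [mk_pi]
    calc Cardinal.prod (fun ξ => #(S ξ)) ≤ Cardinal.prod fun _ : L => σ := prod_le_prod _ _ hS
      _ = σ ^ #L := by simp
      _ ≤ σ ^ σ := power_le_power_left (aleph0_pos.trans_le hσ).ne' hL
      _ = 2 ^ σ := power_self_eq hσ
      _ ≤ χ := h2
  obtain ⟨y, hy⟩ := exists_unbounded_fiber hχ hΛ hI hY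
    (fun α ξ => ⟨ceil (S ξ) (f α ξ), (ceil_spec (hbS ξ) (hb α ξ)).1⟩)
  have hy' : ∀ z, ∃ α, z < α ∧ ∀ ξ, ceil (S ξ) (f α ξ) = y ξ := fun z => by
    obtain ⟨α, h1, h2⟩ := hy z
    exact ⟨α, h2, fun ξ => by rw [← h1]⟩
  have hmono : ∀ α β, α < β → ∀ᶠ ξ in F, ceil (S ξ) (f α ξ) ≤ ceil (S ξ) (f β ξ) := by
    intro α β h
    filter_upwards [hf α β h] with ξ hξ
    have := ceil_spec (hbS ξ) (hb β ξ)
    exact ceil_le this.1 (hξ.trans this.2)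
  have hle : ∀ α, ∀ᶠ ξ in F, ceil (S ξ) (f α ξ) ≤ y ξ := fun α => by
    obtain ⟨β, h1, h2⟩ := hy' α
    filter_upwards [hmono α β h1] with ξ hξ
    rwa [← h2 ξ]
  have hne : Nonempty Λ := mk_ne_zero_iff.1 (bot_lt_iff_ne_bot.1 (bot_le.trans_lt hΛ))
  obtain ⟨a, -, ha⟩ := hy' hne.some
  refine ⟨fun ξ => y ξ, fun α => ?_, a, fun α hα => ?_⟩
  · filter_upwards [hle α] with ξ hξ
    exact (ceil_spec (hbS ξ) (hb α ξ)).2.trans hξ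
  · rcases hα.eq_or_lt with rfl | hα
    · exact Eventually.of_forall ha
    · filter_upwards [hmono a α hα, hle α] with ξ h1 h2
      exact le_antisymm h2 ((ha ξ).symm.le.trans h1)

theorem exists_eventual_lub (F : Filter L) (hσ : ℵ₀ ≤ σ) (hL : #L ≤ σ) (h2 : 2 ^ σ ≤ χ)
    (hΛ : χ < #Λ) (hI : ∀ α : Λ, #(Set.Iic α) ≤ χ) (f : Λ → L → W)
    (hf : ∀ α β, α < β → ∀ᶠ ξ in F, f α ξ ≤ f β ξ) (b : L → W) (hb : ∀ α ξ, f α ξ ≤ b ξ) :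
    ∃ g : L → W, (∀ α, ∀ᶠ ξ in F, f α ξ ≤ g ξ) ∧
      ∀ h : L → W, (∀ α, ∀ᶠ ξ in F, f α ξ ≤ h ξ) → ∀ᶠ ξ in F, g ξ ≤ h ξ := by
  by_contra! hno
  have hχ : ℵ₀ ≤ χ := hσ.trans ((cantor σ).le.trans h2)
  let Z := (Order.succ σ).ord.ToType
  have hZ : #Z = Order.succ σ := mk_ord_toType _
  have hZI : ∀ z : Z, #(Set.Iic z) ≤ σ := mk_Iic_succ_ord_toType_le hσ
  let S : ∀ z : Z, (∀ z', z' < z → L → W) → L → Set W :=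
    fun z gs ξ => insert (b ξ) (Set.range fun z' : Set.Iio z => gs z' z'.2 ξ)
  have key : ∀ (z : Z) (gs : ∀ z', z' < z → L → W), ∃ g : L → W, ∃ a, ∀ α, a ≤ α →
      ∃ ξ, f α ξ ≤ g ξ ∧ g ξ < ceil (S z gs ξ) (f α ξ) := by
    intro z gs
    obtain ⟨h, h1, a, h3⟩ := exists_eventual_ceil F hσ hL h2 hΛ hI f hf b hb (S z gs)
      (fun ξ => Set.mem_insert _ _) (fun ξ => by
        refine (mk_insert_le).trans (add_le_of_le hσ ?_ (one_le_aleph0.trans hσ))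
        exact mk_range_le.trans ((mk_le_mk_of_subset Set.Iio_subset_Iic_self).trans (hZI z)))
    obtain ⟨g, hg1, hg2⟩ := hno h h1
    refine ⟨g, a, fun α hα => ?_⟩
    obtain ⟨ξ, h4, h5, h6⟩ := (hg2.and_eventually ((h3 α hα).and (hg1 α))).exists
    exact ⟨ξ, h6, by rw [h5]; exact h4⟩
  obtain ⟨g, hg⟩ := exists_wf_rec key
  choose a ha using hg
  have hZχ : #Z ≤ χ := hZ.le.trans ((Order.succ_le_of_lt (cantor σ)).trans h2)
  obtain ⟨α, hα⟩ := exists_strict_bound hχ hΛ hI (s := Set.range a) (mk_range_le.trans hZχ)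
  choose ξ hξ1 hξ2 using fun z => ha z α (hα _ ⟨z, rfl⟩).le
  obtain ⟨ξ₀, hξ₀⟩ := exists_unbounded_fiber hσ (hZ ▸ Order.lt_succ σ) hZI hL ξ
  let T : Z → Set W := fun z => S z (fun z' _ => g z') ξ₀
  have hdec : ∀ z z', ξ z = ξ₀ → z < z' → ceil (T z') (f α ξ₀) < ceil (T z) (f α ξ₀) := by
    rintro z z' rfl h
    refine lt_of_le_of_lt (ceil_le ?_ (hξ1 z)) (hξ2 z)
    exact Set.mem_insert_of_mem _ ⟨⟨z, h⟩, rfl⟩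
  have hne : Nonempty Z := mk_ne_zero_iff.1 (by rw [hZ]; exact (Order.bot_lt_succ σ).ne')
  obtain ⟨z₀, hz₀, -⟩ := hξ₀ hne.some
  obtain ⟨_, ⟨z, hz, rfl⟩, hmin⟩ := wellFounded_lt.has_min
    ((fun z => ceil (T z) (f α ξ₀)) '' {z | ξ z = ξ₀}) ⟨_, z₀, hz₀, rfl⟩
  obtain ⟨z', hz', hlt⟩ := hξ₀ z
  exact hmin _ ⟨z', hz', rfl⟩ (hdec z z' hz hlt)

end Lub

namespace Scale

variable {κ χ : Cardinal.{u}} {L W Λ : Type u} [LinearOrder L] [LinearOrder W] [WellFoundedLT W]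
  [LinearOrder Λ] [WellFoundedLT Λ]

theorem exists_eventual_bound (S : Scale κ χ L W) {J : Type u} (hJ : #J ≤ χ) (g : J → L → W)
    (hg : ∀ j ξ, #(Set.Iio (g j ξ)) ≤ S.c ξ) :
    ∃ h : L → W, (∀ ξ, #(Set.Iio (h ξ)) ≤ S.c ξ) ∧ ∀ j, ∀ᶠ ξ in atTop, g j ξ < h ξ := by
  obtain ⟨code⟩ : Nonempty (J ↪ W) := by
    rw [← S.mk_W] at hJ; exact hJ
  let U : L → Set W := fun ξ =>
    ⋃ j : {j // code j < S.mark ξ}, Set.Iic (g j ξ)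
  have hIic : ∀ j ξ, #(Set.Iic (g j ξ)) ≤ S.c ξ := fun j ξ => by
    rw [← Set.Iio_insert]
    exact mk_insert_le.trans (add_le_of_le (S.aleph0_le_c ξ) (hg j ξ)
      (one_le_aleph0.trans (S.aleph0_le_c ξ)))
  have hU : ∀ ξ, #(U ξ) ≤ S.c ξ := fun ξ => by
    have hT : #{j // code j < S.mark ξ} ≤ S.c ξ := by
      rw [← S.mk_Iio_mark ξ]
      exact mk_le_of_injective (f := fun j : {j // code j < S.mark ξ} =>
        (⟨code j, j.2⟩ : Set.Iio (S.mark ξ)))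
        fun x y h => Subtype.ext (code.injective (congrArg Subtype.val h))
    calc #(U ξ) ≤ Cardinal.sum fun j : {j // code j < S.mark ξ} => #(Set.Iic (g j ξ)) :=
          mk_iUnion_le_sum_mk
      _ ≤ Cardinal.sum fun _ : {j // code j < S.mark ξ} => S.c ξ :=
          sum_le_sum _ _ fun j => hIic j ξ
      _ = #{j // code j < S.mark ξ} * S.c ξ := sum_const' _ _
      _ ≤ S.c ξ * S.c ξ := by gcongr
      _ = S.c ξ := mul_eq_self (S.aleph0_le_c ξ)
  have hne : ∀ ξ, ((U ξ)ᶜ).Nonempty := fun ξ => by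
    by_contra h
    rw [Set.not_nonempty_iff_eq_empty, Set.compl_empty_iff] at h
    have := hU ξ
    rw [h, mk_univ, S.mk_W] at this
    exact (S.c_lt ξ).not_ge this
  refine ⟨fun ξ => wellFounded_lt.min _ (hne ξ), fun ξ => ?_, fun j => ?_⟩
  · refine (mk_le_mk_of_subset fun x hx => ?_).trans (hU ξ)
    by_contra hxU
    exact wellFounded_lt.not_lt_min _ hxU hx
  · obtain ⟨ξ₀, h0⟩ := S.exists_lt_c _ (S.mk_Iic_W (code j))
    have := S.nonempty
    filter_upwards [eventually_ge_atTop ξ₀] with ξ hξ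
    have h1 := wellFounded_lt.min_mem _ (hne ξ)
    by_contra! h2
    exact h1 (Set.mem_iUnion.2
      ⟨⟨j, S.lt_mark (h0.trans_le (S.c_strictMono.monotone hξ))⟩, h2⟩)

theorem exists_chain (S : Scale κ χ L W) (hI : ∀ α : Λ, #(Set.Iic α) ≤ χ) :
    ∃ f : Λ → L → W, (∀ α ξ, #(Set.Iio (f α ξ)) ≤ S.c ξ) ∧
      ∀ α β, α < β → ∀ᶠ ξ in atTop, f α ξ < f β ξ := by
  obtain ⟨f, hf⟩ := exists_wf_rec (Λ := Λ) (T := {f : L → W // ∀ ξ, #(Set.Iio (f ξ)) ≤ S.c ξ})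
    (P := fun α gs g => ∀ β h, ∀ᶠ ξ in atTop, (gs β h).1 ξ < g.1 ξ) (fun α gs => by
      obtain ⟨h, h1, h2⟩ := S.exists_eventual_bound (J := Set.Iio α)
        ((mk_le_mk_of_subset Set.Iio_subset_Iic_self).trans (hI α))
        (fun j => (gs j j.2).1) (fun j => (gs j j.2).2)
      exact ⟨⟨h, h1⟩, fun β hβ => h2 ⟨β, hβ⟩⟩)
  exact ⟨fun α => (f α).1, fun α => (f α).2, fun α β h => hf β α h⟩

end Scale

theorem mk_image_le_of_factors {α β γ : Type u} {A : Set α} (r : α → β) (v : α → γ)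
    (h : ∀ x ∈ A, ∀ y ∈ A, r x = r y → v x = v y) : #(v '' A) ≤ #(r '' A) := by
  choose x hx hv using fun y : v '' A => y.2
  refine mk_le_of_injective (f := fun y => (⟨r (x y), x y, hx y, rfl⟩ : r '' A)) fun y z hyz => ?_
  have := h _ (hx y) _ (hx z) (congrArg Subtype.val hyz)
  rw [hv, hv] at this
  exact Subtype.ext this

section Lub

variable {χ m : Cardinal.{u}} {L W Λ : Type u} [LinearOrder W] [LinearOrder Λ]

theorem eventually_approx_lub (F : Filter L) (f : Λ → L → W)
    (hf : ∀ α β, α < β → ∀ᶠ ξ in F, f α ξ < f β ξ) (g : L → W)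
    (hg : ∀ α, ∀ᶠ ξ in F, f α ξ ≤ g ξ)
    (hlub : ∀ h : L → W, (∀ α, ∀ᶠ ξ in F, f α ξ ≤ h ξ) → ∀ᶠ ξ in F, g ξ ≤ h ξ)
    {A : Set Λ} (hA : ∀ z, ∃ α ∈ A, z < α) :
    ∀ᶠ ξ in F, ∀ γ < g ξ, ∃ α ∈ A, γ < f α ξ ∧ f α ξ < g ξ := by
  have hh : ∀ ξ, ∃ w, (∀ α ∈ A, f α ξ < g ξ → f α ξ ≤ w) ∧
      ((∃ γ < g ξ, ∀ α ∈ A, f α ξ < g ξ → f α ξ ≤ γ) → w < g ξ) := fun ξ => by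
    by_cases h : ∃ γ < g ξ, ∀ α ∈ A, f α ξ < g ξ → f α ξ ≤ γ
    · obtain ⟨γ, h1, h2⟩ := h
      exact ⟨γ, h2, fun _ => h1⟩
    · exact ⟨g ξ, fun α _ h => h.le, fun h' => absurd h' h⟩
  choose h h1 h2 using hh
  have := hlub h fun α => by
    obtain ⟨β, hβ, hαβ⟩ := hA α
    obtain ⟨β', -, hβ'⟩ := hA β
    filter_upwards [hf α β hαβ, hf β β' hβ', hg β'] with ξ e1 e2 e3
    exact e1.le.trans (h1 ξ β hβ (e2.trans_le e3))
  filter_upwards [this] with ξ hξ γ hγ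
  by_contra! hc
  refine (h2 ξ ⟨γ, hγ, fun α hα hlt => ?_⟩).not_ge hξ
  by_contra! hlt'
  exact (hc α hα hlt').not_gt hlt

theorem eventually_cofinality_lub (F : Filter L) (hχ : ℵ₀ ≤ χ) (hm : ℵ₀ ≤ m) (hmχ : m ^ #L ≤ χ)
    (hΛ : χ < #Λ) (hI : ∀ α : Λ, #(Set.Iic α) ≤ χ) (f : Λ → L → W)
    (hf : ∀ α β, α < β → ∀ᶠ ξ in F, f α ξ < f β ξ) (g : L → W)
    (hg : ∀ α, ∀ᶠ ξ in F, f α ξ ≤ g ξ)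
    (hlub : ∀ h : L → W, (∀ α, ∀ᶠ ξ in F, f α ξ ≤ h ξ) → ∀ᶠ ξ in F, g ξ ≤ h ξ) :
    ∀ᶠ ξ in F, ∀ T ⊆ Set.Iio (g ξ), #T ≤ m → ∃ γ < g ξ, ∀ s ∈ T, s ≤ γ := by
  by_contra! hno
  have hT : ∀ ξ, ∃ T : Set W, #T ≤ m ∧ ((∃ T ⊆ Set.Iio (g ξ), #T ≤ m ∧ ∀ γ < g ξ, ∃ s ∈ T, γ < s) →
      T ⊆ Set.Iio (g ξ) ∧ ∀ γ < g ξ, ∃ s ∈ T, γ < s) := fun ξ => by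
    by_cases h : ∃ T ⊆ Set.Iio (g ξ), #T ≤ m ∧ ∀ γ < g ξ, ∃ s ∈ T, γ < s
    · obtain ⟨T, h1, h2, h3⟩ := h
      exact ⟨T, h2, fun _ => ⟨h1, h3⟩⟩
    · exact ⟨∅, by simp, fun h' => absurd h' h⟩
  choose T hTm hTQ using hT
  have hp : ∀ α ξ, ∃ p : (insert (g ξ) (T ξ) : Set W),
      (∃ s ∈ T ξ, f α ξ < s) → (p : W) ∈ T ξ ∧ f α ξ < p := fun α ξ => by
    by_cases h : ∃ s ∈ T ξ, f α ξ < s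
    · obtain ⟨s, h1, h2⟩ := h
      exact ⟨⟨s, Set.mem_insert_of_mem _ h1⟩, fun _ => ⟨h1, h2⟩⟩
    · exact ⟨⟨g ξ, Set.mem_insert _ _⟩, fun h' => absurd h' h⟩
  choose p hp using hp
  have hY : #(∀ ξ, (insert (g ξ) (T ξ) : Set W)) ≤ χ := by
    rw [mk_pi]
    calc _ ≤ Cardinal.prod fun _ : L => m := prod_le_prod _ _ fun ξ =>
            mk_insert_le.trans (add_le_of_le hm (hTm ξ) (one_le_aleph0.trans hm))
      _ = m ^ #L := by simp
      _ ≤ χ := hmχ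
  obtain ⟨y, hy⟩ := exists_unbounded_fiber hχ hΛ hI hY p
  have hA : ∀ z, ∃ α ∈ {α | p α = y}, z < α := hy
  have hne : Nonempty Λ := mk_ne_zero_iff.1 (bot_lt_iff_ne_bot.1 (bot_le.trans_lt hΛ))
  obtain ⟨α, hα, -⟩ := hy hne.some
  obtain ⟨β, -, hαβ⟩ := hy α
  obtain ⟨ξ, hQ, h1, h2, h3⟩ := (hno.and_eventually ((hf α β hαβ).and ((hg β).and
    (eventually_approx_lub F f hf g hg hlub hA)))).exists
  obtain ⟨hT1, hT2⟩ := hTQ ξ hQ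
  have h4 := hp α ξ (hT2 _ (h1.trans_le h2))
  rw [hα] at h4
  obtain ⟨α', hα', h5, h6⟩ := h3 _ (hT1 h4.1)
  have h7 := hp α' ξ (hT2 _ h6)
  rw [show p α' = y from hα'] at h7
  exact h5.not_gt h7.2

end Lub

theorem exists_tag {κ : Cardinal.{u}} {L K : Type u} [LinearOrder L] [Nonempty K] (hκ : ℵ₀ ≤ κ)
    (hL : κ < #L) (hI : ∀ ξ : L, #(Set.Iic ξ) ≤ κ) (hK : #K ≤ κ) :
    ∃ tag : L → K, ∀ k ξ, ∃ ξ', tag ξ' = k ∧ ξ < ξ' := by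
  have h : #L = #(L × K) := by
    rw [mk_prod, lift_id, lift_id, mul_eq_left (hκ.trans hL.le) (hK.trans hL.le)
      (mk_ne_zero K)]
  obtain ⟨e⟩ := Cardinal.eq.1 h
  refine ⟨fun ξ => (e ξ).2, fun k ξ => exists_gt_of_lt_mk hI (s := {ξ | (e ξ).2 = k}) ?_ ξ⟩
  refine hL.trans_le (mk_le_of_injective
    (f := fun x : L => (⟨e.symm (x, k), by simp⟩ : {ξ | (e ξ).2 = k})) fun x y hxy => ?_)
  simpa using congrArg Subtype.val hxy

namespace Scale

variable {κ χ : Cardinal.{u}} {L W Λ K : Type u} [LinearOrder L] [LinearOrder W] [LinearOrder Λ]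

theorem exists_tree [WellFoundedLT L] [WellFoundedLT W] [WellFoundedLT Λ] [Nonempty K]
    (S : Scale κ χ L W) (hΛ : χ < #Λ) (hI : ∀ α : Λ, #(Set.Iic α) ≤ χ) (hK : #K ≤ κ) :
    ∃ (η : Λ → L → W) (tag : L → K), Function.Injective η ∧
      (∀ ε, #(Set.range fun (α : Λ) (ε' : Set.Iic ε) => η α ε'.1) < χ) ∧
      ∀ A : Set Λ, χ < #A → ∀ k, ∃ ξ, tag ξ = k ∧ ∃ α ∈ A, ∃ β ∈ A,
        (∀ ξ' < ξ, η α ξ' = η β ξ') ∧ η α ξ < η β ξ := by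
  have := S.nonempty
  obtain ⟨f, hfc, hf⟩ := S.exists_chain hI
  choose next hnext using S.exists_gt
  let b : L → W := fun ξ => S.mark (next ξ)
  have hb : ∀ α ξ, f α ξ < b ξ := fun α ξ => by
    refine S.lt_mark (lt_of_le_of_lt ?_ (S.c_strictMono (hnext ξ)))
    rw [← Set.Iio_insert]
    exact mk_insert_le.trans (add_le_of_le (S.aleph0_le_c ξ) (hfc α ξ)
      (one_le_aleph0.trans (S.aleph0_le_c ξ)))
  have hσ : ℵ₀ ≤ Order.succ κ := S.aleph0_le.trans (Order.le_succ κ)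
  obtain ⟨g, hg, hlub⟩ := exists_eventual_lub atTop hσ S.mk_level.le
    (S.two_power_lt S.succ_lt_χ).le hΛ hI f (fun α β h => (hf α β h).mono fun _ h => h.le) b
    (fun α ξ => (hb α ξ).le)
  have hR : ∀ δ, ∃ P, δ < P ∧ ∀ ξ, P ≤ ξ →
      ∀ T ⊆ Set.Iio (g ξ), #T ≤ 2 ^ S.c δ → ∃ γ < g ξ, ∀ s ∈ T, s ≤ γ := fun δ => by
    have h1 := eventually_cofinality_lub (m := S.c (next δ)) atTop S.aleph0_le_χ
      (S.aleph0_le_c _) (by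
        rw [S.mk_level]; exact (S.power_lt (S.c_lt _) S.succ_lt_χ).le) hΛ hI f hf g hg hlub
    obtain ⟨P, hP⟩ := eventually_atTop.1 h1
    refine ⟨max P (next δ), (hnext δ).trans_le (le_max_right _ _), fun ξ hξ T hT hTc => ?_⟩
    exact hP ξ ((le_max_left _ _).trans hξ) T hT (hTc.trans (S.two_power_le _ _ (hnext δ)))
  choose P hδP hP using hR
  obtain ⟨e, he⟩ := exists_wf_rec (Λ := L) (T := L)
    (P := fun ε gs t => ∃ δ, (∀ ε' h, next (gs ε' h) < δ) ∧ t = P δ) (fun ε gs => by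
      obtain ⟨δ, hδ⟩ := exists_strict_bound S.aleph0_le S.lt_mk_level S.mk_Iic_level
        (s := Set.range fun ε' : Set.Iio ε => next (gs ε' ε'.2))
        (mk_range_le.trans ((mk_le_mk_of_subset Set.Iio_subset_Iic_self).trans
          (S.mk_Iic_level ε)))
      exact ⟨P δ, δ, fun ε' h => hδ _ ⟨⟨ε', h⟩, rfl⟩, rfl⟩)
  choose δ hδ heP using he
  have hmono : StrictMono e := fun ε' ε h => by
    rw [heP ε]
    exact ((hnext _).trans (hδ ε ε' h)).trans (hδP _)
  have hrestr : ∀ (X : Set L) (m : Cardinal.{u}), (∀ ε ∈ X, S.c (next (e ε)) ≤ m) → ℵ₀ ≤ m →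
      #(Set.range fun (α : Λ) (ε' : X) => f α (e ε')) ≤ m ^ Order.succ κ := by
    intro X m hX hm
    calc #(Set.range fun (α : Λ) (ε' : X) => f α (e ε'))
        ≤ #(∀ ε' : X, Set.Iio (b (e ε'))) := by
          refine mk_le_of_injective (f := fun y ε' => ⟨y.1 ε', ?_⟩) fun y z hyz => ?_
          · obtain ⟨α, hα⟩ := y.2
            rw [← hα]; exact hb α _
          · exact Subtype.ext (funext fun ε' => congrArg Subtype.val (congrFun hyz ε'))
      _ = Cardinal.prod fun ε' : X => #(Set.Iio (b (e ε'))) := mk_pi _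
      _ ≤ Cardinal.prod fun _ : X => m := prod_le_prod _ _ fun ε' => by
          rw [S.mk_Iio_mark]; exact hX ε' ε'.2
      _ = m ^ #X := by simp
      _ ≤ m ^ Order.succ κ := power_le_power_left (aleph0_pos.trans_le hm).ne'
          ((mk_set_le X).trans S.mk_level.le)
  obtain ⟨tag, htag⟩ := exists_tag (K := K) S.aleph0_le S.lt_mk_level S.mk_Iic_level hK
  refine ⟨fun α ε => f α (e ε), tag, ?_, fun ε => ?_, fun A hA k => ?_⟩
  · have hne : ∀ α β, α < β → (fun ε => f α (e ε)) ≠ fun ε => f β (e ε) := fun α β h heq => by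
      obtain ⟨ξ, hξ⟩ := eventually_atTop.1 (hf α β h)
      exact (hξ (e ξ) hmono.le_apply).ne (congrFun heq ξ)
    intro α β h
    by_contra hαβ
    rcases lt_or_gt_of_ne hαβ with h' | h'
    · exact hne _ _ h' h
    · exact hne _ _ h' h.symm
  · obtain ⟨ε₁, h1⟩ := S.exists_gt ε
    refine (hrestr (Set.Iic ε) (S.c (e ε₁)) (fun ε' hε' => ?_) (S.aleph0_le_c _)).trans_lt
      (S.power_lt (S.c_lt _) S.succ_lt_χ)
    refine S.c_strictMono.monotone ?_
    rw [heP ε₁]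
    exact ((hδ ε₁ ε' (lt_of_le_of_lt hε' h1)).trans (hδP _)).le
  · obtain ⟨ξ₁, hξ₁⟩ := eventually_atTop.1 (eventually_approx_lub atTop f hf g hg hlub
      (exists_gt_of_lt_mk hI hA))
    obtain ⟨ε, hk, hε⟩ := htag k ξ₁
    refine ⟨ε, hk, ?_⟩
    by_contra! hno
    let r : Λ → Set.Iio ε → W := fun α ε' => f α (e ε')
    have hT : #((fun α => f α (e ε)) '' A) ≤ 2 ^ S.c (δ ε) := by
      refine (mk_image_le_of_factors r _ fun α hα β hβ h => ?_).trans ?_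
      · have h' : ∀ ξ' < ε, f α (e ξ') = f β (e ξ') := fun ξ' hξ' => congrFun h ⟨ξ', hξ'⟩
        exact le_antisymm (hno β hβ α hα fun ξ' hξ' => (h' ξ' hξ').symm) (hno α hα β hβ h')
      · refine (mk_le_mk_of_subset (Set.image_subset_range r A)).trans ?_
        exact (hrestr (Set.Iio ε) (S.c (δ ε)) (fun ε' hε' =>
          S.c_strictMono.monotone (hδ ε ε' hε').le) (S.aleph0_le_c _)).trans (S.c_power_le _)
    obtain ⟨γ, hγ, hbd⟩ := hP (δ ε) (e ε) (heP ε).ge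
      (((fun α => f α (e ε)) '' A) ∩ Set.Iio (g (e ε))) Set.inter_subset_right
      ((mk_le_mk_of_subset Set.inter_subset_left).trans hT)
    obtain ⟨α, hα, h1, h2⟩ := hξ₁ (e ε) (hε.le.trans hmono.le_apply) γ hγ
    exact h1.not_ge (hbd _ ⟨⟨α, hα, rfl⟩, h2⟩)

end Scale

section TreeAlgebra

variable {Λ L W : Type u} [LinearOrder L]

/-- The restrictions of the branches to the levels up to `ξ`. -/
abbrev Cls (η : Λ → L → W) (ξ : L) : Type u :=
  Set.range fun (α : Λ) (ε : Set.Iic ξ) => η α ε.1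

/-- The restriction of a branch to the levels up to `ξ`. -/
def cls (η : Λ → L → W) (ξ : L) (α : Λ) : Cls η ξ := ⟨_, α, rfl⟩

theorem cls_eq_iff {η : Λ → L → W} {ξ : L} {α β : Λ} :
    cls η ξ α = cls η ξ β ↔ ∀ ξ' ≤ ξ, η α ξ' = η β ξ' :=
  ⟨fun h ξ' hξ' => congrFun (congrArg Subtype.val h) ⟨ξ', hξ'⟩,
    fun h => Subtype.ext (funext fun ξ' => h ξ' ξ'.2)⟩

theorem exists_separating [Nonempty L] {η : Λ → L → W} (hη : Function.Injective η)
    (w : Finset Λ) :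
    ∃ ξ, ∀ α ∈ w, ∀ β ∈ w, cls η ξ α = cls η ξ β → α = β := by
  classical
  have h : ∀ p : Λ × Λ, ∃ ξ, p.1 ≠ p.2 → η p.1 ξ ≠ η p.2 ξ := fun p => by
    by_cases hp : p.1 = p.2
    · exact ⟨Classical.arbitrary L, fun h => absurd hp h⟩
    · obtain ⟨ξ, hξ⟩ := Function.ne_iff.1 (hη.ne hp)
      exact ⟨ξ, fun _ => hξ⟩
  choose ξ hξ using h
  obtain ⟨M, hM⟩ := ((w ×ˢ w).image ξ).exists_le
  refine ⟨M, fun α hα β hβ hc => ?_⟩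
  by_contra hne
  exact hξ (α, β) hne (cls_eq_iff.1 hc _
    (hM _ (Finset.mem_image_of_mem ξ (Finset.mk_mem_product hα hβ))))

variable [LinearOrder W]

/-- The branches `α` and `β` agree below `ξ` and `α` turns left of `β` at `ξ`. -/
def SplitsAt (η : Λ → L → W) (ξ : L) (α β : Λ) : Prop :=
  (∀ ξ' < ξ, η α ξ' = η β ξ') ∧ η α ξ < η β ξ

/-- `β` precedes or equals `α` in the partial order of splits at levels in `P`. -/
def initial (η : Λ → L → W) (P : Set L) (α : Λ) : Set Λ :=
  {β | β = α ∨ ∃ ξ ∈ P, SplitsAt η ξ β α}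

variable {η : Λ → L → W} {P : Set L}

theorem initial_subset {ξ : L} (hξ : ξ ∈ P) {α α' : Λ} (h : SplitsAt η ξ α α') :
    initial η P α ⊆ initial η P α' := by
  rintro β (rfl | ⟨ξ', hξ', h'⟩)
  · exact Or.inr ⟨ξ, hξ, h⟩
  · rcases lt_trichotomy ξ ξ' with hlt | rfl | hlt
    · exact Or.inr ⟨ξ, hξ, fun ζ hζ => (h'.1 ζ (hζ.trans hlt)).trans (h.1 ζ hζ),
        (h'.1 ξ hlt).trans_lt h.2⟩
    · exact Or.inr ⟨ξ, hξ, fun ζ hζ => (h'.1 ζ hζ).trans (h.1 ζ hζ), h'.2.trans h.2⟩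
    · exact Or.inr ⟨ξ', hξ', fun ζ hζ => (h'.1 ζ hζ).trans (h.1 ζ (hζ.trans hlt)),
        h'.2.trans_eq (h.1 ξ' hlt)⟩

theorem mem_initial_of_cls_eq {ξ : L} {α β β' : Λ} (h : cls η ξ β = cls η ξ β')
    (hα : cls η ξ α ≠ cls η ξ β) (hβ : β ∈ initial η P α) : β' ∈ initial η P α := by
  rcases hβ with rfl | ⟨ζ, hζ, h1, h2⟩
  · exact absurd rfl hα
  · rw [cls_eq_iff] at h
    have hζξ : ζ ≤ ξ := by
      by_contra! hlt
      exact hα (cls_eq_iff.2 fun ξ' hξ' => (h1 ξ' (hξ'.trans_lt hlt)).symm)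
    refine Or.inr ⟨ζ, hζ, fun ξ' hξ' => ?_, ?_⟩
    · rw [← h ξ' (hξ'.le.trans hζξ)]; exact h1 ξ' hξ'
    · rw [← h ζ hζξ]; exact h2

/-- `y` is described by `w`: membership of a branch in `y` depends, at every level, only on the
restriction of the branch and its membership in the sets `initial η P α` for those `α ∈ w`
having the same restriction. -/
def DescribedBy (η : Λ → L → W) (P : Set L) (w : Finset Λ) (y : Set Λ) : Prop :=
  ∀ ξ β β', cls η ξ β = cls η ξ β' →
    (∀ α ∈ w, cls η ξ α = cls η ξ β → (β ∈ initial η P α ↔ β' ∈ initial η P α)) →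
    (β ∈ y ↔ β' ∈ y)

theorem DescribedBy.mono {w w' : Finset Λ} {y : Set Λ} (h : DescribedBy η P w y) (hw : w ⊆ w') :
    DescribedBy η P w' y :=
  fun ξ β β' h1 h2 => h ξ β β' h1 fun α hα => h2 α (hw hα)

/-- The Boolean algebra of sets of branches described by finitely many branches. -/
def treeAlgebra (η : Λ → L → W) (P : Set L) : BooleanSubalgebra (Set Λ) where
  carrier := {y | ∃ w, DescribedBy η P w y}
  supClosed' := by
    classical
    rintro y ⟨w, hw⟩ y' ⟨w', hw'⟩
    refine ⟨w ∪ w', fun ξ β β' h1 h2 => ?_⟩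
    exact or_congr (hw.mono Finset.subset_union_left ξ β β' h1 h2)
      (hw'.mono Finset.subset_union_right ξ β β' h1 h2)
  infClosed' := by
    classical
    rintro y ⟨w, hw⟩ y' ⟨w', hw'⟩
    refine ⟨w ∪ w', fun ξ β β' h1 h2 => ?_⟩
    exact and_congr (hw.mono Finset.subset_union_left ξ β β' h1 h2)
      (hw'.mono Finset.subset_union_right ξ β β' h1 h2)
  compl_mem' := by
    rintro y ⟨w, hw⟩
    exact ⟨w, fun ξ β β' h1 h2 => not_congr (hw ξ β β' h1 h2)⟩
  bot_mem' := ⟨∅, fun _ _ _ _ _ => Iff.rfl⟩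

theorem initial_mem_treeAlgebra (α : Λ) : initial η P α ∈ treeAlgebra η P := by
  refine ⟨{α}, fun ξ β β' h1 h2 => ?_⟩
  by_cases h : cls η ξ α = cls η ξ β
  · exact h2 α (Finset.mem_singleton_self α) h
  · exact ⟨mem_initial_of_cls_eq h1 h, mem_initial_of_cls_eq h1.symm (h1 ▸ h)⟩

/-- The part of a normal form lying in a class. -/
def piece (η : Λ → L → W) (P : Set L) {ξ : L} (t₁ t₂ : Set (Cls η ξ)) (q : Cls η ξ) (α : Λ) :
    Set Λ :=
  {β | (q ∈ t₁ ∧ β ∈ initial η P α) ∨ (q ∈ t₂ ∧ β ∉ initial η P α)}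

theorem piece_subset_or {ξ ζ : L} {t₁ t₂ : Set (Cls η ξ)} {q : Cls η ξ} (hζ : ζ ∈ P) {α α' : Λ}
    (h : SplitsAt η ζ α α') :
    piece η P t₁ t₂ q α ⊆ piece η P t₁ t₂ q α' ∨ piece η P t₁ t₂ q α' ⊆ piece η P t₁ t₂ q α := by
  have hs := initial_subset hζ h
  by_cases h1 : q ∈ t₁
  · refine Or.inl ?_
    rintro β (⟨-, hβ⟩ | ⟨h2, -⟩)
    · exact Or.inl ⟨h1, hs hβ⟩
    · by_cases hβ : β ∈ initial η P α'
      exacts [Or.inl ⟨h1, hβ⟩, Or.inr ⟨h2, hβ⟩]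
  · refine Or.inr ?_
    rintro β (⟨h1', -⟩ | ⟨h2, hβ⟩)
    · exact absurd h1' h1
    · exact Or.inr ⟨h2, fun h => hβ (hs h)⟩

/-- The shape of an element of the algebra: a level, a finite set of exceptional classes, and the
types of the classes. -/
abbrev Shape (η : Λ → L → W) : Type u :=
  Σ ξ : L, Finset (Cls η ξ) × Set (Cls η ξ) × Set (Cls η ξ)

/-- The element of given shape with parameters `a`. -/
def normalForm (η : Λ → L → W) (P : Set L) (d : Shape η) (a : d.2.1 → Λ) : Set Λ :=
  {β | (∃ h : cls η d.1 β ∈ d.2.1, β ∈ piece η P d.2.2.1 d.2.2.2 (cls η d.1 β) (a ⟨_, h⟩)) ∨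
    cls η d.1 β ∉ d.2.1 ∧ cls η d.1 β ∈ d.2.2.1}

theorem exists_normalForm [Nonempty L] (hη : Function.Injective η) {y : Set Λ}
    (hy : y ∈ treeAlgebra η P) : ∃ d a, y = normalForm η P d a := by
  classical
  obtain ⟨w, hw⟩ := hy
  obtain ⟨ξ, hξ⟩ := exists_separating hη w
  let R : Finset (Cls η ξ) := w.image (cls η ξ)
  have ha : ∀ q : R, ∃ α ∈ w, cls η ξ α = q := fun q => Finset.mem_image.1 q.2
  choose a haw ha using ha
  have huniq : ∀ (q : R), ∀ α ∈ w, cls η ξ α = q → α = a q := fun q α hα h =>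
    hξ α hα _ (haw q) (h.trans (ha q).symm)
  let t₁ : Set (Cls η ξ) :=
    {q | ∃ β ∈ y, cls η ξ β = q ∧ ∀ h : q ∈ R, β ∈ initial η P (a ⟨q, h⟩)}
  let t₂ : Set (Cls η ξ) :=
    {q | ∃ β ∈ y, cls η ξ β = q ∧ ∃ h : q ∈ R, β ∉ initial η P (a ⟨q, h⟩)}
  refine ⟨⟨ξ, R, t₁, t₂⟩, a, ?_⟩
  ext β
  by_cases hR : cls η ξ β ∈ R
  · have hdesc : ∀ β', cls η ξ β' = cls η ξ β →
        (β' ∈ initial η P (a ⟨_, hR⟩) ↔ β ∈ initial η P (a ⟨_, hR⟩)) → (β' ∈ y ↔ β ∈ y) :=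
      fun β' h1 h2 => hw ξ β' β h1 fun α hα h => by
        rw [huniq ⟨_, hR⟩ α hα (h.trans h1)]; exact h2
    constructor
    · intro hβ
      refine Or.inl ⟨hR, ?_⟩
      by_cases hx : β ∈ initial η P (a ⟨_, hR⟩)
      · exact Or.inl ⟨⟨β, hβ, rfl, fun _ => hx⟩, hx⟩
      · exact Or.inr ⟨⟨β, hβ, rfl, hR, hx⟩, hx⟩
    · rintro (⟨_, ⟨⟨β', h1, h2, h3⟩, hx⟩ | ⟨⟨β', h1, h2, _, h3⟩, hx⟩⟩ | ⟨h, -⟩)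
      · exact (hdesc β' h2 (iff_of_true (h3 hR) hx)).1 h1
      · exact (hdesc β' h2 (iff_of_false h3 hx)).1 h1
      · exact absurd hR h
  · constructor
    · exact fun hβ => Or.inr ⟨hR, β, hβ, rfl, fun h => absurd h hR⟩
    · rintro (⟨h, -⟩ | ⟨-, β', h1, h2, -⟩)
      · exact absurd h hR
      · refine (hw ξ β' β h2 fun α hα h => ?_).1 h1
        exact absurd (Finset.mem_image_of_mem _ hα) (h ▸ h2 ▸ hR)

end TreeAlgebra

section Spread

theorem exists_large_fiber {α β : Type u} {μ : Cardinal.{u}} (hμ : ℵ₀ ≤ μ) (hα : μ < #α)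
    (hβ : #β ≤ μ) (φ : α → β) : ∃ b, μ < #{x // φ x = b} := by
  by_contra! h
  refine hα.not_ge ?_
  calc #α = #(Σ b, {x // φ x = b}) := mk_congr (Equiv.sigmaFiberEquiv φ).symm
    _ = Cardinal.sum fun b => #{x // φ x = b} := mk_sigma _
    _ ≤ Cardinal.sum fun _ : β => μ := sum_le_sum _ _ h
    _ = #β * μ := sum_const' _ _
    _ ≤ μ * μ := by gcongr
    _ = μ := mul_eq_self hμ

variable {Λ L W : Type u} [LinearOrder L] {η : Λ → L → W} {P : Set L} {χ : Cardinal.{u}}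

theorem mk_shape_le (hχ : ℵ₀ ≤ χ) (hL : #L ≤ χ) (hcls : ∀ ξ, 2 ^ #(Cls η ξ) ≤ χ) :
    #(Shape η) ≤ χ := by
  have h : ∀ ξ, #(Finset (Cls η ξ) × Set (Cls η ξ) × Set (Cls η ξ)) ≤ χ := fun ξ => by
    have h1 : #(Set (Cls η ξ)) ≤ χ := by rw [mk_set]; exact hcls ξ
    have h2 : #(Finset (Cls η ξ)) ≤ χ :=
      (mk_le_of_injective Finset.coe_injective).trans h1
    simp only [mk_prod, lift_id]
    exact mul_le_of_le hχ h2 (mul_le_of_le hχ h1 h1)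
  calc #(Shape η) = Cardinal.sum fun ξ =>
        #(Finset (Cls η ξ) × Set (Cls η ξ) × Set (Cls η ξ)) := mk_sigma _
    _ ≤ Cardinal.sum fun _ : L => χ := sum_le_sum _ _ h
    _ = #L * χ := sum_const' _ _
    _ ≤ χ := mul_le_of_le hχ hL le_rfl

variable [LinearOrder W]

theorem mk_treeAlgebra_le [Nonempty L] (hη : Function.Injective η) (hχ : ℵ₀ ≤ χ) (hL : #L ≤ χ)
    (hcls : ∀ ξ, 2 ^ #(Cls η ξ) ≤ χ) (hΛ : #Λ ≤ Order.succ χ) :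
    #(treeAlgebra η P) ≤ Order.succ χ := by
  have hχ' := hχ.trans (Order.le_succ χ)
  choose d a hda using fun y : treeAlgebra η P => exists_normalForm hη y.2
  calc #(treeAlgebra η P) ≤ #(Σ d : Shape η, (d.2.1 → Λ)) := by
        refine mk_le_of_injective (f := fun y => ⟨d y, a y⟩) fun y z hyz => Subtype.ext ?_
        rw [hda y, hda z]
        exact congrArg (fun p : (Σ d : Shape η, (d.2.1 → Λ)) => normalForm η P p.1 p.2) hyz
    _ = Cardinal.sum fun d : Shape η => #(d.2.1 → Λ) := mk_sigma _
    _ ≤ Cardinal.sum fun _ : Shape η => Order.succ χ := sum_le_sum _ _ fun d => by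
        rw [mk_arrow, lift_id, lift_id]
        refine (power_le_power_right hΛ).trans ?_
        simpa using power_nat_le hχ'
    _ = #(Shape η) * Order.succ χ := sum_const' _ _
    _ ≤ Order.succ χ :=
        mul_le_of_le hχ' ((mk_shape_le hχ hL hcls).trans (Order.le_succ χ)) le_rfl

theorem mk_idealIndep_treeAlgebra_le [Nonempty L] (hη : Function.Injective η) (hχ : ℵ₀ ≤ χ)
    (hL : #L ≤ χ) (hcls : ∀ ξ, 2 ^ #(Cls η ξ) ≤ χ)
    (hsplit : ∀ A : Set Λ, χ < #A → ∃ ξ ∈ P, ∃ α ∈ A, ∃ β ∈ A, SplitsAt η ξ α β)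
    {X : Set (treeAlgebra η P)} (hX : IdealIndep X) : #X ≤ χ := by
  classical
  by_contra! hlt
  choose d a hda using fun y : treeAlgebra η P => exists_normalForm hη y.2
  obtain ⟨⟨ξ, R, t₁, t₂⟩, hd⟩ :=
    exists_large_fiber hχ hlt (mk_shape_le hχ hL hcls) (fun y : X => d y)
  let X' : Set (treeAlgebra η P) := {y | y ∈ X ∧ d y = ⟨ξ, R, t₁, t₂⟩}
  have hX' : χ < #X' := by
    refine hd.trans_le (mk_le_of_injective (f := fun y => (⟨y.1.1, y.1.2, y.2⟩ : X'))
      fun y z h => Subtype.ext (Subtype.ext (Subtype.mk.inj h)))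
  have hnf : ∀ y ∈ X', ∃ a, (y : Set Λ) = normalForm η P ⟨ξ, R, t₁, t₂⟩ a := by
    rintro y ⟨-, hy⟩
    have := hda y
    generalize a y = a' at this
    revert a'
    rw [hy]
    exact fun a' h => ⟨a', h⟩
  have hne : Nonempty (R → Λ) := by
    obtain ⟨y, hy⟩ := mk_ne_zero_iff.1 (bot_lt_iff_ne_bot.1 (bot_le.trans_lt hX'))
    exact ⟨(hnf y hy).choose⟩
  choose! b hb using hnf
  let bad : R → Set (treeAlgebra η P) := fun q => {y | y ∈ X' ∧ ∀ y' ∈ X', y' ≠ y →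
    ¬ piece η P t₁ t₂ q.1 (b y q) ⊆ piece η P t₁ t₂ q.1 (b y' q)}
  have hbad : ∀ q, #(bad q) ≤ χ := fun q => by
    by_contra! hlt
    have hinj : Set.InjOn (fun y => b y q) (bad q) := fun y hy z hz h => by
      by_contra hne
      exact hy.2 z hz.1 (Ne.symm hne) (by simp only at h; rw [h])
    rw [← mk_image_eq_of_injOn _ _ hinj] at hlt
    obtain ⟨ζ, hζ, _, ⟨y, hy, rfl⟩, _, ⟨z, hz, rfl⟩, hs⟩ := hsplit _ hlt
    have hne : z ≠ y := by
      rintro rfl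
      exact hs.2.ne rfl
    rcases piece_subset_or hζ hs (t₁ := t₁) (t₂ := t₂) (q := q.1) with h | h
    · exact hy.2 z hz.1 hne h
    · exact hz.2 y hy.1 hne.symm h
  have hU : #(⋃ q, bad q) ≤ χ := by
    calc #(⋃ q, bad q) ≤ Cardinal.sum fun q => #(bad q) := mk_iUnion_le_sum_mk
      _ ≤ Cardinal.sum fun _ : R => χ := sum_le_sum _ _ hbad
      _ = #R * χ := sum_const' _ _
      _ ≤ χ := mul_le_of_le hχ ((lt_aleph0_of_finite R).le.trans hχ) le_rfl
  obtain ⟨y, hy, hyU⟩ : ∃ y ∈ X', y ∉ ⋃ q, bad q := by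
    by_contra! h
    exact hX'.not_ge ((mk_le_mk_of_subset h).trans hU)
  obtain ⟨z, hz, hzy⟩ : ∃ z ∈ X', z ≠ y := by
    by_contra! h
    refine hX'.not_ge ((mk_le_mk_of_subset (t := {y}) h).trans ?_)
    simpa using one_le_aleph0.trans hχ
  have hgood : ∀ q : R, ∃ y' ∈ X', y' ≠ y ∧
      piece η P t₁ t₂ q.1 (b y q) ⊆ piece η P t₁ t₂ q.1 (b y' q) := fun q => by
    by_contra! h
    exact hyU (Set.mem_iUnion.2 ⟨q, hy, fun y' h1 h2 => h y' h1 h2⟩)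
  choose g hgX hgy hg using hgood
  refine hX y hy.1 (insert z (Finset.univ.image g)) ?_ ?_
  · intro x hx
    rw [Finset.mem_coe, Finset.mem_insert, Finset.mem_image] at hx
    rcases hx with rfl | ⟨q, -, rfl⟩
    exacts [⟨hz.1, hzy⟩, ⟨(hgX q).1, hgy q⟩]
  · intro β hβ
    have hsup : ∀ x ∈ insert z (Finset.univ.image g), (x : Set Λ) ⊆
        ((insert z (Finset.univ.image g)).sup id : treeAlgebra η P) := fun x hx =>
      Finset.le_sup (f := id) hx
    have hβ' : β ∈ (y : Set Λ) := hβ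
    rw [hb y hy] at hβ'
    rcases hβ' with ⟨hR, hp⟩ | hR
    · refine hsup (g ⟨_, hR⟩) (Finset.mem_insert_of_mem
        (Finset.mem_image_of_mem _ (Finset.mem_univ _))) ?_
      rw [hb _ (hgX _)]
      exact Or.inl ⟨hR, hg ⟨_, hR⟩ hp⟩
    · refine hsup z (Finset.mem_insert_self _ _) ?_
      rw [hb z hz]
      exact Or.inr hR

theorem spreadBA_le {A : Type u} [BooleanAlgebra A]
    (h : ∀ X : Set A, IdealIndep X → #X ≤ χ) : spreadBA A ≤ χ :=
  csSup_le' (by rintro _ ⟨X, hX, rfl⟩; exact h X hX)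

theorem le_spreadBA {A : Type u} [BooleanAlgebra A] {X : Set A} (hX : IdealIndep X) :
    #X ≤ spreadBA A :=
  le_csSup ⟨#A, by rintro _ ⟨X, -, rfl⟩; exact mk_set_le X⟩ ⟨X, hX, rfl⟩

end Spread

section Ultraproduct

variable {Λ L W : Type u} [LinearOrder L] [LinearOrder W] {η : Λ → L → W} {P : I → Set L}

/-- The class in the ultraproduct of the sequence of initial sets of `α`. -/
def initialClass (η : Λ → L → W) (D : Ultrafilter I) (P : I → Set L) (α : Λ) :
    UProd D fun i => treeAlgebra η (P i) :=
  Quotient.mk _ fun i => ⟨initial η (P i) α, initial_mem_treeAlgebra α⟩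

theorem SplitsAt.unique {ξ ξ' : L} {α β : Λ} (h : SplitsAt η ξ α β) (h' : SplitsAt η ξ' α β) :
    ξ = ξ' := by
  rcases lt_trichotomy ξ ξ' with hlt | rfl | hlt
  · exact absurd (h'.1 ξ hlt) h.2.ne
  · rfl
  · exact absurd (h.1 ξ' hlt) h'.2.ne

theorem eventually_notMem_initial {D : Ultrafilter I}
    (hP : ∀ ξ, ∀ᶠ i in (D : Filter I), ξ ∉ P i) {α β : Λ} (h : β ≠ α) :
    ∀ᶠ i in (D : Filter I), α ∉ initial η (P i) β := by
  by_cases hs : ∃ ξ, SplitsAt η ξ α β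
  · obtain ⟨ξ, hξ⟩ := hs
    filter_upwards [hP ξ] with i hi
    rintro (rfl | ⟨ξ', hξ', h'⟩)
    · exact h rfl
    · exact hi (hξ.unique h' ▸ hξ')
  · refine Eventually.of_forall fun i => ?_
    rintro (rfl | ⟨ξ', -, h'⟩)
    · exact h rfl
    · exact hs ⟨ξ', h'⟩

theorem not_initialClass_le {D : Ultrafilter I} (hP : ∀ ξ, ∀ᶠ i in (D : Filter I), ξ ∉ P i)
    {α : Λ} (F : Finset (UProd D fun i => treeAlgebra η (P i)))
    (hF : ∀ x ∈ F, ∃ β, β ≠ α ∧ x = initialClass η D P β) :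
    ¬ initialClass η D P α ≤ F.sup id := by
  classical
  have key : ∃ h : ∀ i, treeAlgebra η (P i), F.sup id = Quotient.mk _ h ∧
      ∀ᶠ i in (D : Filter I), α ∉ (h i : Set Λ) := by
    induction F using Finset.induction_on with
    | empty => exact ⟨fun _ => ⊥, rfl, Eventually.of_forall fun _ h => h⟩
    | insert x F _ ih =>
      obtain ⟨h, h1, h2⟩ := ih fun y hy => hF y (Finset.mem_insert_of_mem hy)
      obtain ⟨β, hβ, rfl⟩ := hF x (Finset.mem_insert_self _ _)
      refine ⟨fun i => (⟨initial η (P i) β, initial_mem_treeAlgebra β⟩ : treeAlgebra η (P i)) ⊔ h i,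
        ?_, ?_⟩
      · rw [Finset.sup_insert, h1]
        rfl
      · filter_upwards [h2, eventually_notMem_initial (η := η) hP hβ] with i h3 h4
        exact fun h5 => h5.elim h4 h3
  obtain ⟨h, h1, h2⟩ := key
  rw [h1]
  intro hle
  have hle' : ∀ᶠ i in (D : Filter I),
    (⟨initial η (P i) α, initial_mem_treeAlgebra α⟩ : treeAlgebra η (P i)) ≤ h i := hle
  obtain ⟨i, h3, h4⟩ := (hle'.and h2).exists
  exact h4 (h3 (Or.inl rfl))

theorem initialClass_injective {D : Ultrafilter I}
    (hP : ∀ ξ, ∀ᶠ i in (D : Filter I), ξ ∉ P i) :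
    Function.Injective (initialClass η D P) := fun α β h => by
  by_contra hne
  refine not_initialClass_le (η := η) hP {initialClass η D P β} (α := α)
    (fun x hx => ⟨β, Ne.symm hne, Finset.mem_singleton.1 hx⟩) ?_
  rw [Finset.sup_singleton, h]
  exact le_rfl

theorem idealIndep_range_initialClass {D : Ultrafilter I}
    (hP : ∀ ξ, ∀ᶠ i in (D : Filter I), ξ ∉ P i) :
    IdealIndep (Set.range (initialClass η D P)) := by
  rintro _ ⟨α, rfl⟩ F hF
  refine not_initialClass_le hP F fun x hx => ?_
  obtain ⟨⟨β, rfl⟩, hne⟩ := hF hx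
  exact ⟨β, fun h => hne (h ▸ rfl), rfl⟩

theorem mk_uprod_le (D : Ultrafilter I) {B : I → Type u} {μ : Cardinal.{u}}
    (hB : ∀ i, #(B i) ≤ μ) : #(UProd D B) ≤ μ ^ #I := by
  refine (mk_quotient_le (s := upSetoid D B)).trans ?_
  rw [mk_pi]
  exact (prod_le_prod _ _ hB).trans (by simp)

theorem eventually_lt_of_uniform {κ : Cardinal.{u}} (hκ : ℵ₀ ≤ κ) {D : Ultrafilter I}
    (hD : ∀ s ∈ D, #s = κ) (e : I ≃ κ.ord.ToType) (k : κ.ord.ToType) :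
    ∀ᶠ i in (D : Filter I), ¬ e i ≤ k := by
  rw [Ultrafilter.eventually_not]
  intro h
  refine (mk_Iic_ord_toType_lt hκ k).not_ge ?_
  refine (hD _ h).ge.trans ?_
  exact mk_le_of_injective (f := fun i : {i | e i ≤ k} => (⟨e i, i.2⟩ : Set.Iic k))
    fun i j hij => Subtype.ext (e.injective (congrArg Subtype.val hij))

end Ultraproduct

end SpreadUltra

open SpreadUltra

theorem stmt_17 (κ : Cardinal.{u}) (hκ : ℵ₀ ≤ κ) (I : Type u) (hI : #I = κ)
    (D : Ultrafilter I) (hD : ∀ s ∈ D, #s = κ) (θ : Cardinal.{u}) :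
    ∃ χ : Cardinal.{u}, θ ≤ χ ∧ χ ^ κ = χ ∧
      ∃ (B : I → Type u) (_ : ∀ i, BooleanAlgebra (B i)),
        (∀ i, spreadBA (B i) ≤ χ) ∧ spreadBA (UProd D B) = Order.succ χ := by
  obtain ⟨χ, hθ, ⟨S⟩⟩ := exists_scale hκ θ
  have hχ := S.aleph0_le_χ
  have hne := S.nonempty
  let Λ := (Order.succ χ).ord.ToType
  have hΛ : #Λ = Order.succ χ := mk_ord_toType _
  have hK : #κ.ord.ToType = κ := mk_ord_toType κ
  have : Nonempty κ.ord.ToType :=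
    mk_ne_zero_iff.1 (by rw [hK]; exact (aleph0_pos.trans_le hκ).ne')
  obtain ⟨η, tag, hη, hcls, hsplit⟩ := S.exists_tree (Λ := Λ) (K := κ.ord.ToType)
    (hΛ ▸ Order.lt_succ χ) (mk_Iic_succ_ord_toType_le hχ) hK.le
  have hcls' : ∀ ξ, 2 ^ #(Cls η ξ) ≤ χ := fun ξ => (S.two_power_lt (hcls ξ)).le
  have hL := S.mk_level.le.trans S.succ_lt_χ.le
  obtain ⟨e⟩ := Cardinal.eq.1 (hI.trans hK.symm)
  let P : I → Set _ := fun i => {ξ | e i ≤ tag ξ}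
  have hP : ∀ ξ, ∀ᶠ i in (D : Filter I), ξ ∉ P i := fun ξ =>
    eventually_lt_of_uniform hκ hD e (tag ξ)
  refine ⟨χ, hθ, S.χ_power, fun i => treeAlgebra η (P i), fun i => inferInstance, fun i => ?_,
    le_antisymm ?_ ?_⟩
  · refine spreadBA_le fun X hX => mk_idealIndep_treeAlgebra_le hη hχ hL hcls' (fun A hA => ?_) hX
    obtain ⟨ξ, hξ, α, hα, β, hβ, h⟩ := hsplit A hA (e i)
    exact ⟨ξ, hξ.ge, α, hα, β, hβ, h⟩
  · refine spreadBA_le fun X _ => (mk_set_le X).trans ?_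
    refine (mk_uprod_le D fun i => mk_treeAlgebra_le hη hχ hL hcls' hΛ.le).trans ?_
    rw [hI, S.succ_χ_power]
  · rw [← hΛ, ← mk_range_eq _ (initialClass_injective (η := η) hP)]
    exact le_spreadBA (idealIndep_range_initialClass hP)
end
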